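/- arXiv:2009.02817 — 6 statements merged into one kernel-verified Lean document; each statement's English description precedes it below -/
import Mathlib

section
/- Let X and Y be compact metric spaces with metrics ρ and σ respectively, and let π : X → Y be a continuous onto map. Then π is a strong near homeomorphism if and only if π satisfies the strong shrinking criterion. -/
open Metric Set Function

universe u v

/-- A collection of subsets of a (pseudo)metric space is *null* if for every `ε > 0`
only finitely many of its members have diameter `≥ ε`. -/
def IsNullCollection {X : Type u} [PseudoMetricSpace X] (𝒞 : Set (Set X)) : Prop :=
  ∀ ε : ℝ, 0 < ε → {C | C ∈ 𝒞 ∧ ε ≤ Metric.diam C}.Finite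

/-- An upper semi-continuous decomposition of a space `X`: a partition of `X` into
nonempty compact subsets such that the quotient map to the quotient space
(with the quotient topology) is a closed map. -/
def IsUSCDecomposition {X : Type u} [TopologicalSpace X] (𝒢 : Set (Set X)) : Prop :=
  (∀ G ∈ 𝒢, IsCompact G ∧ G.Nonempty) ∧
  (∀ x : X, ∃! G, G ∈ 𝒢 ∧ x ∈ G) ∧
  IsClosedMap (Quot.mk (fun x y : X => ∃ G ∈ 𝒢, x ∈ G ∧ y ∈ G))

/-- `f` maps `S` homeomorphically onto `T`. -/
def MapsHomeomorphicallyOnto {X : Type u} {Y : Type v} [TopologicalSpace X]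
    [TopologicalSpace Y] (f : X → Y) (S : Set X) (T : Set Y) : Prop :=
  ∃ e : S ≃ₜ T, ∀ x : S, (e x : Y) = f (x : X)

/-- A compact subset `A` of a metric space `X` is *squeezable* if for every null
upper semi-continuous decomposition `𝒢` of `X` with `A ∈ 𝒢`, every open neighborhood
`U` of `A` and every `δ > 0`, there is a homeomorphism `h : X → X` which is the identity
on `X − U`, with `diam (h '' A) < δ`, and such that for every `G ∈ 𝒢` either
`diam (h '' G) < δ` or `h` is the identity on `G`. -/
def Squeezable {X : Type u} [MetricSpace X] (A : Set X) : Prop :=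
  IsCompact A ∧
    ∀ 𝒢 : Set (Set X), IsUSCDecomposition 𝒢 → IsNullCollection 𝒢 → A ∈ 𝒢 →
      ∀ U : Set X, IsOpen U → A ⊆ U → ∀ δ : ℝ, 0 < δ →
        ∃ h : X ≃ₜ X, (∀ x ∈ Uᶜ, h x = x) ∧ Metric.diam (⇑h '' A) < δ ∧
          ∀ G ∈ 𝒢, Metric.diam (⇑h '' G) < δ ∨ ∀ x ∈ G, h x = x

/-- A compact subset `A` of a metric space `X` is *squashable* if for every null
upper semi-continuous decomposition `𝒢` of `X` with `A ∈ 𝒢`, every open neighborhood `U`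
of `A` and every `δ > 0`, there is a continuous map `f : X → X` in the closure (in `C(X,X)`)
of the set of homeomorphisms of `X` fixing `X − U` pointwise, such that `f '' A` is a
one-point set `{p}`, `f` maps `X − A` homeomorphically onto `X − {p}`, and for every
`G ∈ 𝒢` either `diam (f '' G) < δ` or `f` is the identity on `G`. -/
def Squashable {X : Type u} [MetricSpace X] (A : Set X) : Prop :=
  IsCompact A ∧
    ∀ 𝒢 : Set (Set X), IsUSCDecomposition 𝒢 → IsNullCollection 𝒢 → A ∈ 𝒢 →
      ∀ U : Set X, IsOpen U → A ⊆ U → ∀ δ : ℝ, 0 < δ →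
        ∃ (f : C(X, X)) (p : X),
          f ∈ closure ((fun h : X ≃ₜ X => (h : C(X, X))) ''
              {h : X ≃ₜ X | ∀ x ∈ Uᶜ, h x = x}) ∧
          ⇑f '' A = {p} ∧
          MapsHomeomorphicallyOnto (⇑f) Aᶜ ({p}ᶜ) ∧
          ∀ G ∈ 𝒢, Metric.diam (⇑f '' G) < δ ∨ ∀ x ∈ G, f x = x

/-- `π` injects over `C` if `π` is injective on `π ⁻¹' C`. -/
def InjectsOver {X : Type u} {Y : Type v} (π : X → Y) (C : Set Y) : Prop :=
  Set.InjOn π (π ⁻¹' C)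

/-- The strong shrinking criterion for an onto map `π : X → Y` between compact metric
spaces. -/
def SatisfiesStrongShrinkingCriterion {X : Type u} {Y : Type v} [MetricSpace X]
    [MetricSpace Y] (π : X → Y) : Prop :=
  ∀ δ : ℝ, 0 < δ → ∀ C : Set Y, IsClosed C → InjectsOver π C →
    ∃ h : X ≃ₜ X,
      (∀ y : Y, Metric.diam (⇑h '' (π ⁻¹' {y})) < δ) ∧
      (∀ x : X, dist (π x) (π (h.symm x)) < δ) ∧
      ∀ x ∈ π ⁻¹' C, h x = x

/-- `π : X → Y` is a strong near homeomorphism. -/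
def IsStrongNearHomeomorphism {X : Type u} {Y : Type v} [MetricSpace X]
    [MetricSpace Y] (π : X → Y) : Prop :=
  ∀ ε : ℝ, 0 < ε → ∀ C : Set Y, IsClosed C → InjectsOver π C →
    ∃ f : X ≃ₜ Y, (∀ x : X, dist (π x) (f x) < ε) ∧ ∀ x ∈ π ⁻¹' C, f x = π x

/-- A subset of `ℝⁿ` is starlike if it is compact and contains a point `x` such that the
segment from `x` to any of its points lies in it. -/
def IsStarlike {n : ℕ} (A : Set (EuclideanSpace ℝ (Fin n))) : Prop :=
  IsCompact A ∧ ∃ x ∈ A, ∀ y ∈ A, segment ℝ x y ⊆ A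

/-- A subset `A` of a space `X` is starlike-equivalent if some open neighborhood of `A`
embeds onto an open subset of some `ℝⁿ` (`n ≥ 1`) carrying `A` onto a starlike set. -/
def IsStarlikeEquivalent {X : Type u} [TopologicalSpace X] (A : Set X) : Prop :=
  ∃ n : ℕ, 1 ≤ n ∧ ∃ U : Set X, IsOpen U ∧ A ⊆ U ∧
    ∃ e : U → EuclideanSpace ℝ (Fin n), Topology.IsEmbedding e ∧ IsOpen (Set.range e) ∧
      IsStarlike (e '' {x : U | (x : X) ∈ A})

/-- The image `A/B` of `A` in the quotient `X/B` of `X` obtained by identifying the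
compact set `B ⊆ A` to a point is a squeezable subset of `X/B`, for some
(equivalently, by metric-independence, any) metric inducing the quotient topology.
The quotient `X/B` is modelled by an arbitrary compact metric space `Y` together with a
continuous surjection `π : X → Y` whose fibers are `B` and the singletons of `X − B`
(such a map from the compact space `X` to the metrizable space `Y` is automatically a
closed quotient map, so `Y` is `X/B` with a metric inducing the quotient topology). -/
def SqueezableInQuotient {X : Type u} [MetricSpace X] (B A : Set X) : Prop :=
  ∃ (Y : Type u) (mY : MetricSpace Y) (π : X → Y),
    letI := mY
    Continuous π ∧ Function.Surjective π ∧
      (∀ x y : X, π x = π y ↔ x = y ∨ (x ∈ B ∧ y ∈ B)) ∧ Squeezable (π '' A)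

/-- `A/B` is a squashable subset of `X/B`; see `SqueezableInQuotient`. -/
def SquashableInQuotient {X : Type u} [MetricSpace X] (B A : Set X) : Prop :=
  ∃ (Y : Type u) (mY : MetricSpace Y) (π : X → Y),
    letI := mY
    Continuous π ∧ Function.Surjective π ∧
      (∀ x y : X, π x = π y ↔ x = y ∨ (x ∈ B ∧ y ∈ B)) ∧ Squashable (π '' A)

/-- `A/B` is a starlike-equivalent subset of `X/B`; see `SqueezableInQuotient`. -/
def StarlikeEquivalentInQuotient {X : Type u} [MetricSpace X] (B A : Set X) : Prop :=
  ∃ (Y : Type u) (mY : MetricSpace Y) (π : X → Y),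
    letI := mY
    Continuous π ∧ Function.Surjective π ∧
      (∀ x y : X, π x = π y ↔ x = y ∨ (x ∈ B ∧ y ∈ B)) ∧ IsStarlikeEquivalent (π '' A)

/-- `A` is recursively squeezable of filtration length `≤ n`: there is a chain
`A₁ ⊆ ⋯ ⊆ A_{n+1} = A` of compact subsets of `X` with `A₁` squeezable in `X` and
`A_{i+1}/A_i` squeezable in `X/A_i` for each `i`. -/
def RecursivelySqueezableOfLength {X : Type u} [MetricSpace X] (n : ℕ) (A : Set X) :
    Prop :=
  ∃ F : Fin (n + 1) → Set X,
    (∀ i, IsCompact (F i)) ∧ Monotone F ∧ F (Fin.last n) = A ∧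
    Squeezable (F 0) ∧ ∀ i : Fin n, SqueezableInQuotient (F i.castSucc) (F i.succ)

/-- `A` is recursively squeezable: recursively squeezable of filtration length `≤ n`
for some `n ≥ 0`. -/
def RecursivelySqueezable {X : Type u} [MetricSpace X] (A : Set X) : Prop :=
  ∃ n : ℕ, RecursivelySqueezableOfLength n A

/-- `A` is recursively squashable of filtration length `≤ n`. -/
def RecursivelySquashableOfLength {X : Type u} [MetricSpace X] (n : ℕ) (A : Set X) :
    Prop :=
  ∃ F : Fin (n + 1) → Set X,
    (∀ i, IsCompact (F i)) ∧ Monotone F ∧ F (Fin.last n) = A ∧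
    Squashable (F 0) ∧ ∀ i : Fin n, SquashableInQuotient (F i.castSucc) (F i.succ)

/-- `A` is recursively squashable. -/
def RecursivelySquashable {X : Type u} [MetricSpace X] (A : Set X) : Prop :=
  ∃ n : ℕ, RecursivelySquashableOfLength n A

/-- `A` is recursively starlike-equivalent of filtration length `≤ n`. -/
def RecursivelyStarlikeEquivalentOfLength {X : Type u} [MetricSpace X] (n : ℕ)
    (A : Set X) : Prop :=
  ∃ F : Fin (n + 1) → Set X,
    (∀ i, IsCompact (F i)) ∧ Monotone F ∧ F (Fin.last n) = A ∧
    IsStarlikeEquivalent (F 0) ∧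
    ∀ i : Fin n, StarlikeEquivalentInQuotient (F i.castSucc) (F i.succ)

/-- `A` is recursively starlike-equivalent. -/
def RecursivelyStarlikeEquivalent {X : Type u} [MetricSpace X] (A : Set X) : Prop :=
  ∃ n : ℕ, RecursivelyStarlikeEquivalentOfLength n A

/-- The continuous maps separating any two points at distance at least `r` form an open set. -/
theorem isOpen_setOf_separating {X : Type u} {Y : Type v} [MetricSpace X] [CompactSpace X]
    [MetricSpace Y] (r : ℝ) :
    IsOpen {f : C(X, Y) | ∀ x x', r ≤ dist x x' → f x ≠ f x'} := by
  have hK : IsClosed {q : C(X, Y) × (X × X) | r ≤ dist q.2.1 q.2.2 ∧ q.1 q.2.1 = q.1 q.2.2} :=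
    IsClosed.and (isClosed_le (by fun_prop) (by fun_prop)) (isClosed_eq (by fun_prop) (by fun_prop))
  convert (isClosedMap_fst_of_compactSpace _ hK).isOpen_compl using 1
  ext f
  simp

/-- The surjective continuous maps from a compact space form a closed set. -/
theorem isClosed_setOf_surjective {X : Type u} {Y : Type v} [MetricSpace X] [CompactSpace X]
    [MetricSpace Y] : IsClosed {f : C(X, Y) | Function.Surjective f} := by
  simp only [Function.Surjective, ofPred_forall]
  refine isClosed_iInter fun y => ?_
  have hK : IsClosed {q : C(X, Y) × X | q.1 q.2 = y} :=
    isClosed_eq (by fun_prop) continuous_const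
  convert isClosedMap_fst_of_compactSpace _ hK using 1
  ext f
  simp

theorem IsStrongNearHomeomorphism.satisfiesStrongShrinkingCriterion {X : Type u} {Y : Type v}
    [MetricSpace X] [MetricSpace Y] [CompactSpace Y] {π : X → Y}
    (H : IsStrongNearHomeomorphism π) : SatisfiesStrongShrinkingCriterion π := by
  intro δ hδ C hC hinj
  obtain ⟨g, hg, hgC⟩ := H (δ / 2) (half_pos hδ) C hC hinj
  have huc : UniformContinuous g.symm :=
    CompactSpace.uniformContinuous_of_continuous g.symm.continuous
  obtain ⟨η, hη, hgη⟩ := Metric.uniformContinuous_iff.1 huc (δ / 2) (half_pos hδ)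
  obtain ⟨f, hf, hfC⟩ := H (min (δ / 2) (η / 2))
    (lt_min (half_pos hδ) (half_pos hη)) C hC hinj
  refine ⟨f.trans g.symm, fun y => ?_, fun x => ?_, fun x hx => ?_⟩
  · refine lt_of_le_of_lt (Metric.diam_le_of_forall_dist_le (half_pos hδ).le ?_) (half_lt_self hδ)
    rintro _ ⟨a, ha, rfl⟩ _ ⟨b, hb, rfl⟩
    refine (hgη ?_).le
    have h1 := (hf a).trans_le (min_le_right _ _)
    have h2 := (hf b).trans_le (min_le_right _ _)
    rw [show π a = y from ha, dist_comm] at h1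
    rw [show π b = y from hb] at h2
    change dist (f a) (f b) < η
    linarith [dist_triangle (f a) y (f b)]
  · have h1 := hg x
    have h2 := (hf (f.symm (g x))).trans_le (min_le_left _ _)
    rw [f.apply_symm_apply, dist_comm] at h2
    change dist (π x) (π (f.symm (g x))) < δ
    linarith [dist_triangle (π x) (g x) (π (f.symm (g x)))]
  · change g.symm (f x) = x
    rw [hfC x hx, ← hgC x hx, g.symm_apply_apply]

/-- The maps `π ∘ k`, for `k` a homeomorphism of `X` fixing the preimage of `C` pointwise. -/
def homeomorphOrbit {X : Type u} {Y : Type v} [TopologicalSpace X] [TopologicalSpace Y]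
    (π : C(X, Y)) (C : Set Y) : Set C(X, Y) :=
  {f | ∃ k : X ≃ₜ X, (∀ x ∈ π ⁻¹' C, k x = x) ∧ ∀ x, f x = π (k x)}

theorem exists_separating_mem_homeomorphOrbit {X : Type u} {Y : Type v} [MetricSpace X]
    [CompactSpace X] [MetricSpace Y] {π : C(X, Y)}
    (H : SatisfiesStrongShrinkingCriterion π) {C : Set Y} (hC : IsClosed C)
    (hinj : InjectsOver π C) {f : C(X, Y)} (hf : f ∈ homeomorphOrbit π C) {r ε : ℝ}
    (hr : 0 < r) (hε : 0 < ε) :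
    ∃ g ∈ homeomorphOrbit π C, (∀ x x', r ≤ dist x x' → g x ≠ g x') ∧ dist f g < ε := by
  obtain ⟨k, hkC, hk⟩ := hf
  have huc : UniformContinuous k.symm :=
    CompactSpace.uniformContinuous_of_continuous k.symm.continuous
  obtain ⟨η, hη, hkη⟩ := Metric.uniformContinuous_iff.1 huc r hr
  obtain ⟨h, hdiam, hclose, hhC⟩ := H (min η ε) (lt_min hη hε) C hC hinj
  refine ⟨π.comp ⟨fun x => h.symm (k x), by fun_prop⟩, ⟨k.trans h.symm, fun x hx => ?_,
    fun x => rfl⟩, fun x x' hxx' he => ?_, ?_⟩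
  · change h.symm (k x) = x
    rw [hkC x hx, h.symm_apply_eq, hhC x hx]
  · have hmem : ∀ z, π (h.symm (k z)) = π (h.symm (k x')) →
        k z ∈ h '' (π ⁻¹' {π (h.symm (k x'))}) :=
      fun z hz => ⟨h.symm (k z), hz, h.apply_symm_apply _⟩
    have hd := (Metric.dist_le_diam_of_mem isBounded_of_compactSpace
      (hmem x he) (hmem x' rfl)).trans_lt ((hdiam _).trans_le (min_le_left _ _))
    have := hkη hd
    rw [k.symm_apply_apply, k.symm_apply_apply] at this
    exact this.not_ge hxx'
  · rw [ContinuousMap.dist_lt_iff hε]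
    intro x
    rw [hk x]
    exact (hclose (k x)).trans_le (min_le_right _ _)

theorem SatisfiesStrongShrinkingCriterion.isStrongNearHomeomorphism {X : Type u} {Y : Type v}
    [MetricSpace X] [CompactSpace X] [MetricSpace Y] [CompactSpace Y] {π : C(X, Y)}
    (hsurj : Function.Surjective π) (H : SatisfiesStrongShrinkingCriterion π) :
    IsStrongNearHomeomorphism π := by
  intro ε hε C hC hinj
  let T : Set C(X, Y) := closure (homeomorphOrbit π C)
  have : CompleteSpace T := isClosed_closure.completeSpace_coe
  let U : ℕ → Set T := fun n =>
    (↑) ⁻¹' {f : C(X, Y) | ∀ x x', (1 / ((n : ℝ) + 1)) ≤ dist x x' → f x ≠ f x'}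
  have hdense : Dense (⋂ n, U n) := by
    refine dense_iInter_of_isOpen_nat
      (fun n => (isOpen_setOf_separating _).preimage continuous_subtype_val) fun n => ?_
    rw [Metric.dense_iff]
    rintro ⟨t, ht⟩ r hr
    obtain ⟨f, hf, htf⟩ := Metric.mem_closure_iff.1 ht (r / 2) (half_pos hr)
    obtain ⟨g, hg, hsep, hfg⟩ := exists_separating_mem_homeomorphOrbit H hC hinj hf
      (Nat.one_div_pos_of_nat (α := ℝ) (n := n)) (half_pos hr)
    refine ⟨⟨g, subset_closure hg⟩, ?_, hsep⟩
    change dist g t < r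
    rw [dist_comm]
    linarith [dist_triangle t f g]
  have hπT : π ∈ T := subset_closure ⟨Homeomorph.refl X, fun _ _ => rfl, fun _ => rfl⟩
  obtain ⟨⟨f, hfT⟩, hfU, hfε⟩ := hdense.exists_dist_lt ⟨π, hπT⟩ hε
  have hfinj : Function.Injective f := by
    intro x x' hxx'
    by_contra hne
    obtain ⟨n, hn⟩ := exists_nat_one_div_lt (dist_pos.2 hne)
    exact mem_iInter.1 hfU n x x' hn.le hxx'
  have hfsurj : Function.Surjective f := by
    refine closure_minimal ?_ isClosed_setOf_surjective hfT
    rintro g ⟨k, -, hk⟩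
    rw [mem_ofPred_eq, show ⇑g = π ∘ k from funext hk]
    exact hsurj.comp k.surjective
  refine ⟨Continuous.homeoOfEquivCompactToT2 (f := Equiv.ofBijective f ⟨hfinj, hfsurj⟩)
    f.continuous, (ContinuousMap.dist_lt_iff hε).1 hfε, fun x hx => ?_⟩
  refine closure_minimal (t := {g : C(X, Y) | g x = π x}) ?_
    (isClosed_eq (by fun_prop) continuous_const) hfT
  rintro g ⟨k, hkC, hk⟩
  rw [mem_ofPred_eq, hk, hkC x hx]

/-- **The Strong Bing Shrinking Theorem.** An onto map `π : X → Y` between compact metric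
spaces is a strong near homeomorphism if and only if it satisfies the strong shrinking
criterion. -/
theorem strong_bing_shrinking {X : Type u} {Y : Type v} [MetricSpace X] [CompactSpace X]
    [MetricSpace Y] [CompactSpace Y] (π : X → Y) (hπ : Continuous π)
    (hsurj : Function.Surjective π) :
    IsStrongNearHomeomorphism π ↔ SatisfiesStrongShrinkingCriterion π := by
  exact ⟨fun H => H.satisfiesStrongShrinkingCriterion,
    fun H => SatisfiesStrongShrinkingCriterion.isStrongNearHomeomorphism (π := ⟨π, hπ⟩) hsurj H⟩
end

section
/- If 𝒢 is a null upper semi-continuous decomposition of a compact metric space X each of whose non-singleton elements is a squeezable subset of X, then 𝒢 is strongly shrinkable, i.e., the quotient map π : X → X/𝒢 satisfies the strong shrinking criterion. -/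
open Metric Set Function

universe u v

/-- A homeomorphism that is the identity off `U` maps `U` into itself. -/
theorem Homeomorph.apply_mem_of_eqOn_compl {X : Type u} [TopologicalSpace X] {U : Set X}
    (h : X ≃ₜ X) (hU : ∀ x ∈ Uᶜ, h x = x) {x : X} (hx : x ∈ U) : h x ∈ U := by
  by_contra hn
  have hfix : h x = x := h.injective (hU _ hn)
  exact hn (hfix.symm ▸ hx)

/-- Finitely many homeomorphisms supported in pairwise disjoint sets can be combined into one. -/
theorem Homeomorph.exists_combine {X : Type u} [TopologicalSpace X] {ι : Type v}
    (U : ι → Set X) (f : ι → X ≃ₜ X) (s : Finset ι)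
    (hdisj : (s : Set ι).PairwiseDisjoint U) (hf : ∀ i ∈ s, ∀ x ∈ (U i)ᶜ, f i x = x) :
    ∃ h : X ≃ₜ X, (∀ i ∈ s, ∀ x ∈ U i, h x = f i x) ∧ ∀ x, (∀ i ∈ s, x ∉ U i) → h x = x := by
  classical
  induction s using Finset.induction_on with
  | empty => exact ⟨Homeomorph.refl X, by simp, by simp⟩
  | insert a s ha ih =>
    obtain ⟨h, h_on, h_off⟩ := ih (hdisj.subset (by simp))
      fun i hi => hf i (Finset.mem_insert_of_mem hi)
    have hne : ∀ i ∈ s, ∀ x ∈ U i, x ∉ U a := fun i hi x hxi hxa =>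
      Set.disjoint_left.1 (hdisj (by simp [hi]) (by simp) (by rintro rfl; exact ha hi)) hxi hxa
    refine ⟨h.trans (f a), fun i hi x hx => ?_, fun x hx => ?_⟩
    · rw [Homeomorph.trans_apply]
      rcases Finset.mem_insert.1 hi with rfl | his
      · rw [h_off x fun j hj hxj => hne j hj x hxj hx]
      · rw [h_on i his x hx]
        exact hf a (by simp) _ (hne i his _ ((f i).apply_mem_of_eqOn_compl (hf i hi) hx))
    · rw [Homeomorph.trans_apply, h_off x fun i hi => hx i (Finset.mem_insert_of_mem hi)]
      exact hf a (by simp) x (hx a (by simp))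

/-- **Theorem 1.** If `𝒢` is a null upper semi-continuous decomposition of a compact
metric space `X` each of whose non-singleton elements is squeezable, then `𝒢` is strongly
shrinkable: the quotient map `π : X → X/𝒢` satisfies the strong shrinking criterion.
Here the quotient space `X/𝒢`, with a fixed metric inducing the quotient topology, is
modelled by a compact metric space `Y` together with a continuous surjection `π : X → Y`
whose fibers are exactly the elements of `𝒢` (such a map is automatically a closed
quotient map since `X` is compact and `Y` is Hausdorff). -/
theorem null_decomposition_squeezable_strongly_shrinkable {X : Type u} {Y : Type v}
    [MetricSpace X] [CompactSpace X] [MetricSpace Y] [CompactSpace Y]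
    (𝒢 : Set (Set X)) (hdec : IsUSCDecomposition 𝒢) (hnull : IsNullCollection 𝒢)
    (hsq : ∀ G ∈ 𝒢, (¬ ∃ x : X, G = {x}) → Squeezable G)
    (π : X → Y) (hπ : Continuous π) (hsurj : Function.Surjective π)
    (hfib : ∀ x y : X, π x = π y ↔ ∃ G ∈ 𝒢, x ∈ G ∧ y ∈ G) :
    SatisfiesStrongShrinkingCriterion π := by
  intro δ hδ C hC hinj
  have hmem : ∀ y, π ⁻¹' {y} ∈ 𝒢 := by
    intro y
    obtain ⟨x, rfl⟩ := hsurj y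
    obtain ⟨G, ⟨hG, hxG⟩, -⟩ := hdec.2.1 x
    convert hG using 1
    ext z
    rw [mem_preimage, mem_singleton_iff, hfib]
    refine ⟨?_, fun hz => ⟨G, hG, hz, hxG⟩⟩
    rintro ⟨G', hG', hz, hx⟩
    rwa [(hdec.2.1 x).unique ⟨hG, hxG⟩ ⟨hG', hx⟩]
  have hT : {y | δ ≤ Metric.diam (π ⁻¹' {y})}.Finite := by
    refine Set.Finite.of_finite_image
      ((hnull δ hδ).subset (image_subset_iff.2 fun y hy => ⟨hmem y, hy⟩)) ?_
    exact ((preimage_injective.2 hsurj).comp singleton_injective).injOn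
  have hns : ∀ y, δ ≤ Metric.diam (π ⁻¹' {y}) → ¬ (π ⁻¹' {y}).Subsingleton := fun y hy hs => by
    rw [Metric.diam_subsingleton hs] at hy
    linarith
  have hnC : ∀ y, δ ≤ Metric.diam (π ⁻¹' {y}) → y ∉ C := fun y hy hyC =>
    hns y hy fun a ha b hb => hinj (by rwa [mem_preimage, show π a = y from ha])
      (by rwa [mem_preimage, show π b = y from hb]) (Eq.trans ha (Eq.symm hb))
  obtain ⟨W, hW, hWdisj⟩ := hT.t2_separation
  let U : Y → Set Y := fun y => W y ∩ (Metric.ball y (δ / 2) ∩ Cᶜ)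
  have hyU : ∀ y, δ ≤ Metric.diam (π ⁻¹' {y}) → y ∈ U y := fun y hy =>
    ⟨(hW y).1, Metric.mem_ball_self (half_pos hδ), hnC y hy⟩
  have hex : ∀ y, ∃ h : X ≃ₜ X, δ ≤ Metric.diam (π ⁻¹' {y}) →
      (∀ x ∈ (π ⁻¹' U y)ᶜ, h x = x) ∧ Metric.diam (h '' (π ⁻¹' {y})) < δ ∧
        ∀ G ∈ 𝒢, Metric.diam (h '' G) < δ ∨ ∀ x ∈ G, h x = x := by
    intro y
    by_cases hy : δ ≤ Metric.diam (π ⁻¹' {y})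
    · obtain ⟨h, hh⟩ := (hsq _ (hmem y) fun ⟨x, hx⟩ => hns y hy (hx ▸ subsingleton_singleton)).2
        𝒢 hdec hnull (hmem y) (π ⁻¹' U y)
        (((hW y).2.inter (Metric.isOpen_ball.inter hC.isOpen_compl)).preimage hπ)
        (preimage_mono (singleton_subset_iff.2 (hyU y hy))) δ hδ
      exact ⟨h, fun _ => hh⟩
    · exact ⟨Homeomorph.refl X, fun h => absurd h hy⟩
  choose f hf using hex
  obtain ⟨h, h_on, h_off⟩ := Homeomorph.exists_combine (fun y => π ⁻¹' U y) f hT.toFinset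
    (fun a ha b hb hab => ((hWdisj (by simpa using ha) (by simpa using hb) hab).mono
      inter_subset_left inter_subset_left).preimage π)
    (fun y hy => (hf y (by simpa using hy)).1)
  simp only [Finite.mem_toFinset, mem_ofPred_eq, mem_preimage] at h_on h_off
  refine ⟨h, fun y => ?_, fun x => ?_, fun x hx => h_off x fun y _ hxy => hxy.2.2 hx⟩
  · by_cases hy : ∃ t, δ ≤ Metric.diam (π ⁻¹' {t}) ∧ y ∈ U t
    · obtain ⟨t, ht, hyt⟩ := hy
      have himg : h '' (π ⁻¹' {y}) = f t '' (π ⁻¹' {y}) :=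
        image_congr fun x hx => h_on t ht x (by rwa [show π x = y from hx])
      rw [himg]
      by_cases hbig : δ ≤ Metric.diam (π ⁻¹' {y})
      · obtain rfl : y = t := by
          by_contra hne
          exact Set.disjoint_left.1 (hWdisj hbig ht hne) (hW y).1 hyt.1
        exact (hf y ht).2.1
      · refine ((hf t ht).2.2 _ (hmem y)).elim id fun hid => ?_
        rw [image_congr hid, image_id']
        exact not_le.1 hbig
    · push Not at hy
      rw [image_congr fun x hx => h_off x fun t ht => by
        rw [show π x = y from hx]; exact hy t ht, image_id']
      exact not_le.1 fun hbig => hy y hbig (hyU y hbig)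
  · obtain ⟨z, rfl⟩ := h.surjective x
    rw [h.symm_apply_apply]
    by_cases hz : ∃ t, δ ≤ Metric.diam (π ⁻¹' {t}) ∧ π z ∈ U t
    · obtain ⟨t, ht, hzt⟩ := hz
      have hmaps : π (h z) ∈ U t := by
        rw [h_on t ht z hzt]
        exact (f t).apply_mem_of_eqOn_compl (hf t ht).1 hzt
      have h₁ := Metric.mem_ball.1 hmaps.2.1
      have h₂ := Metric.mem_ball.1 hzt.2.1
      linarith [dist_triangle_right (π (h z)) (π z) t]
    · push Not at hz
      rwa [h_off z hz, dist_self]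
end

section
/- Every starlike-equivalent subset of a compact metric space is squeezable. -/
open Metric Set Function

universe u v

/-- The distance to a set that is star-shaped about the origin does not increase when a point is
moved towards the origin. -/
theorem StarConvex.infDist_smul_le {E : Type*} [NormedAddCommGroup E] [NormedSpace ℝ E]
    {B : Set E} (hB : StarConvex ℝ 0 B) (hne : B.Nonempty) {t : ℝ} (ht0 : 0 ≤ t) (ht1 : t ≤ 1)
    (x : E) : infDist (t • x) B ≤ infDist x B := by
  refine (le_infDist hne).2 fun b hb => ?_
  have htb : t • b ∈ B := by
    simpa using hB hb (sub_nonneg.2 ht1) ht0 (by ring)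
  calc infDist (t • x) B ≤ dist (t • x) (t • b) := infDist_le_dist_of_mem htb
    _ = t * dist x b := by rw [dist_smul₀, Real.norm_of_nonneg ht0]
    _ ≤ dist x b := mul_le_of_le_one_left dist_nonneg ht1

/-- The radial map which increases the reciprocal of the norm of each `x ≠ 0` by `s x`. -/
noncomputable def radialSqueeze {E : Type*} [NormedAddCommGroup E] [NormedSpace ℝ E]
    (s : E → ℝ) (x : E) : E :=
  (1 + s x * ‖x‖)⁻¹ • x

theorem one_add_mul_norm_pos {E : Type*} [NormedAddCommGroup E] {s : E → ℝ} (hs : ∀ x, 0 ≤ s x)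
    (x : E) : 0 < 1 + s x * ‖x‖ :=
  add_pos_of_pos_of_nonneg one_pos (mul_nonneg (hs x) (norm_nonneg x))

section RadialSqueeze

variable {E : Type*} [NormedAddCommGroup E] [NormedSpace ℝ E] {s : E → ℝ}

theorem radialSqueeze_of_eq_zero {x : E} (h : s x = 0) : radialSqueeze s x = x := by
  simp [radialSqueeze, h]

theorem continuous_radialSqueeze (hs : ∀ x, 0 ≤ s x) (hc : Continuous s) :
    Continuous (radialSqueeze s) := by
  unfold radialSqueeze
  exact ((continuous_const.add (hc.mul continuous_norm)).inv₀
    fun x => (one_add_mul_norm_pos hs x).ne').smul continuous_id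

theorem mul_norm_radialSqueeze_le (hs : ∀ x, 0 ≤ s x) (x : E) :
    s x * ‖radialSqueeze s x‖ ≤ 1 := by
  have h := one_add_mul_norm_pos hs x
  rw [radialSqueeze, norm_smul, norm_inv, Real.norm_of_nonneg h.le, ← mul_assoc,
    mul_comm (s x), mul_assoc, inv_mul_le_iff₀ h]
  linarith

theorem radialSqueeze_injective (hs : ∀ x, 0 ≤ s x)
    (hr : ∀ x, ∀ t : ℝ, 0 ≤ t → t ≤ 1 → s x ≤ s (t • x)) :
    Injective (radialSqueeze s) := by
  have key : ∀ x y : E, ‖x‖ ≤ ‖y‖ → radialSqueeze s x = radialSqueeze s y → x = y := by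
    intro x y hxy h
    have hx := one_add_mul_norm_pos hs x
    have hy := one_add_mul_norm_pos hs y
    have hxe : x = ((1 + s x * ‖x‖) * (1 + s y * ‖y‖)⁻¹) • y := by
      rw [mul_smul, ← radialSqueeze.eq_1 s y, ← h, radialSqueeze, smul_inv_smul₀ hx.ne']
    set c := (1 + s x * ‖x‖) * (1 + s y * ‖y‖)⁻¹ with hc
    have hc0 : 0 < c := mul_pos hx (inv_pos.2 hy)
    have hn : ‖x‖ = c * ‖y‖ := by
      conv_lhs => rw [hxe]
      rw [norm_smul, Real.norm_of_nonneg hc0.le]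
    rcases eq_or_ne y 0 with rfl | hy0
    · simpa using hxe
    have hyn : 0 < ‖y‖ := norm_pos_iff.2 hy0
    have hc1 : c ≤ 1 := by
      by_contra! hlt
      nlinarith
    have hsle : s y ≤ s x := by
      have := hr y c hc0.le hc1
      rwa [← hxe] at this
    have hce : c * (1 + s y * ‖y‖) = 1 + s x * ‖x‖ := by
      rw [hc, inv_mul_cancel_right₀ hy.ne']
    have hc2 : c = 1 := by
      rw [hn] at hce
      nlinarith [mul_nonneg (mul_nonneg hc0.le hyn.le) (sub_nonneg.2 hsle)]
    rw [hxe, hc2, one_smul]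
  intro x y h
  rcases le_total ‖x‖ ‖y‖ with hxy | hxy
  · exact key x y hxy h
  · exact (key y x hxy h.symm).symm

theorem radialSqueeze_surjective (hs : ∀ x, 0 ≤ s x) (hc : Continuous s) {R : ℝ}
    (hR : ∀ x, R ≤ ‖x‖ → s x = 0) : Surjective (radialSqueeze s) := by
  intro y
  rcases eq_or_ne y 0 with rfl | hy0
  · exact ⟨0, by simp [radialSqueeze]⟩
  have hyn : 0 < ‖y‖ := norm_pos_iff.2 hy0
  set T : ℝ := max 1 (R / ‖y‖)
  have hT1 : 1 ≤ T := le_max_left _ _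
  have hTs : s (T • y) = 0 := by
    refine hR _ ?_
    rw [norm_smul, Real.norm_of_nonneg (by linarith)]
    exact (div_le_iff₀ hyn).1 (le_max_right _ _)
  have hcont : ContinuousOn (fun t : ℝ => t - s (t • y) * ‖t • y‖) (Icc 1 T) := by
    fun_prop
  have hmem : (1 : ℝ) ∈ Icc ((1 : ℝ) - s ((1 : ℝ) • y) * ‖(1 : ℝ) • y‖)
      (T - s (T • y) * ‖T • y‖) := by
    constructor
    · linarith [mul_nonneg (hs ((1 : ℝ) • y)) (norm_nonneg ((1 : ℝ) • y))]
    · simpa [hTs] using hT1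
  obtain ⟨t, ⟨ht1, -⟩, ht⟩ := intermediate_value_Icc hT1 hcont hmem
  refine ⟨t • y, ?_⟩
  have : 1 + s (t • y) * ‖t • y‖ = t := by
    simp only at ht
    linarith
  rw [radialSqueeze, this, inv_smul_smul₀ (by linarith)]

theorem dist_radialSqueeze_le (hs : ∀ x, 0 ≤ s x) (x y : E) :
    dist (radialSqueeze s x) (radialSqueeze s y) ≤
      3 * dist x y + ‖x‖ ^ 2 * |s x - s y| := by
  have hx := one_add_mul_norm_pos hs x
  have hy := one_add_mul_norm_pos hs y
  have hxn := norm_nonneg x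
  have hyn := norm_nonneg y
  have hz : 0 < 1 + s y * ‖x‖ := add_pos_of_pos_of_nonneg one_pos (mul_nonneg (hs y) hxn)
  set z : E := (1 + s y * ‖x‖)⁻¹ • x with hzdef
  have h1 : dist (radialSqueeze s x) z ≤ ‖x‖ ^ 2 * |s x - s y| := by
    have he : (1 + s x * ‖x‖)⁻¹ - (1 + s y * ‖x‖)⁻¹
        = (s y - s x) * ‖x‖ * ((1 + s x * ‖x‖) * (1 + s y * ‖x‖))⁻¹ := by
      rw [inv_sub_inv hx.ne' hz.ne', div_eq_mul_inv]
      ring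
    have hone : ((1 + s x * ‖x‖) * (1 + s y * ‖x‖))⁻¹ ≤ 1 := by
      refine inv_le_one_of_one_le₀ ?_
      nlinarith [mul_nonneg (hs x) hxn, mul_nonneg (hs y) hxn,
        mul_nonneg (mul_nonneg (hs x) hxn) (mul_nonneg (hs y) hxn)]
    rw [dist_eq_norm, radialSqueeze, hzdef, ← sub_smul, he, norm_smul, norm_mul, norm_mul,
      norm_norm, Real.norm_of_nonneg (inv_nonneg.2 (mul_pos hx hz).le), Real.norm_eq_abs,
      abs_sub_comm]
    calc |s x - s y| * ‖x‖ * ((1 + s x * ‖x‖) * (1 + s y * ‖x‖))⁻¹ * ‖x‖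
        ≤ |s x - s y| * ‖x‖ * 1 * ‖x‖ := by gcongr
      _ = _ := by ring
  have h2 : dist z (radialSqueeze s y) ≤ 3 * dist x y := by
    have he : z - radialSqueeze s y = ((1 + s y * ‖x‖) * (1 + s y * ‖y‖))⁻¹ •
        ((1 + s y * ‖x‖) • (x - y) - (s y * (‖x‖ - ‖y‖)) • x) := by
      rw [eq_inv_smul_iff₀ (mul_pos hz hy).ne', hzdef, radialSqueeze, smul_sub,
        mul_smul _ _ ((1 + s y * ‖y‖)⁻¹ • y), smul_inv_smul₀ hy.ne', mul_comm, mul_smul,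
        smul_inv_smul₀ hz.ne']
      module
    have hb : ‖(1 + s y * ‖x‖) • (x - y) - (s y * (‖x‖ - ‖y‖)) • x‖ ≤
        (1 + 2 * (s y * ‖x‖)) * dist x y := by
      refine (norm_sub_le _ _).trans ?_
      rw [norm_smul, norm_smul, Real.norm_of_nonneg hz.le, norm_mul, Real.norm_of_nonneg (hs y),
        Real.norm_eq_abs, dist_eq_norm]
      have : s y * |‖x‖ - ‖y‖| * ‖x‖ ≤ s y * ‖x - y‖ * ‖x‖ := by
        gcongr
        · exact hs y
        · exact abs_norm_sub_norm_le x y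
      linarith
    rw [dist_eq_norm, he, norm_smul, norm_inv, Real.norm_of_nonneg (mul_pos hz hy).le,
      inv_mul_le_iff₀ (mul_pos hz hy)]
    refine hb.trans ?_
    rw [← mul_assoc _ 3]
    refine mul_le_mul_of_nonneg_right ?_ dist_nonneg
    nlinarith [mul_nonneg (hs y) hxn, mul_nonneg (hs y) hyn,
        mul_nonneg (mul_nonneg (hs y) hxn) (mul_nonneg (hs y) hyn)]
  linarith [dist_triangle (radialSqueeze s x) z (radialSqueeze s y)]

end RadialSqueeze

/-- A staircase function: if every member of `𝒯` which comes close to `0` stays close to `0`, there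
are nonincreasing functions with arbitrarily small support and arbitrarily large value at `0` whose
oscillation on each member of `𝒯` is at most `τ`. -/
theorem exists_antitone_oscillation_le {𝒯 : Set (Set ℝ)}
    (h𝒯 : ∀ ε > 0, ∃ ε' > 0, ∀ T ∈ 𝒯, (∃ t ∈ T, t < ε') → ∀ t ∈ T, t < ε)
    {τ : ℝ} (hτ : 0 ≤ τ) (k : ℕ) {ε : ℝ} (hε : 0 < ε) :
    ∃ σ : ℝ → ℝ, Continuous σ ∧ Antitone σ ∧ (∀ t, 0 ≤ σ t) ∧ (∀ t, ε ≤ t → σ t = 0) ∧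
      (∃ ε' > 0, ∀ t ≤ ε', σ t = k * τ) ∧ ∀ T ∈ 𝒯, ∀ a ∈ T, ∀ b ∈ T, |σ a - σ b| ≤ τ := by
  induction k with
  | zero =>
    exact ⟨fun _ => 0, continuous_const, antitone_const, fun _ => le_rfl, fun _ _ => rfl,
      ⟨1, one_pos, by simp⟩, by simpa using fun _ _ _ _ _ _ => hτ⟩
  | succ k ih =>
    obtain ⟨σ, hc, ha, h0, hsupp, ⟨ε₁, hε₁, htop⟩, hosc⟩ := ih
    obtain ⟨ε₂, hε₂, hT⟩ := h𝒯 (min ε₁ ε) (lt_min hε₁ hε)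
    set m := min ε₂ ε with hm
    have hmpos : 0 < m := lt_min hε₂ hε
    set χ : ℝ → ℝ := fun t => max 0 (min 1 (2 - 2 * t / m)) with hχ
    have hχ0 : ∀ t, 0 ≤ χ t := fun t => le_max_left _ _
    have hχ1 : ∀ t, χ t ≤ 1 := fun t => max_le zero_le_one (min_le_left _ _)
    have hχsupp : ∀ t, m ≤ t → χ t = 0 := by
      intro t ht
      refine max_eq_left ((min_le_right _ _).trans ?_)
      have : 2 ≤ 2 * t / m := by
        rw [le_div_iff₀ hmpos]
        linarith
      linarith
    have hχtop : ∀ t, t ≤ m / 2 → χ t = 1 := by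
      intro t ht
      have : 2 * t / m ≤ 1 := by
        rw [div_le_one hmpos]
        linarith
      simp only [hχ]
      rw [min_eq_left (by linarith), max_eq_right zero_le_one]
    refine ⟨fun t => σ t + χ t * τ, by fun_prop, ?_, fun t => ?_, fun t ht => ?_,
      ⟨min ε₁ (m / 2), lt_min hε₁ (half_pos hmpos), fun t ht => ?_⟩, ?_⟩
    · intro a b hab
      have hχab : χ b ≤ χ a := by
        simp only [hχ]
        gcongr
      exact add_le_add (ha hab) (mul_le_mul_of_nonneg_right hχab hτ)
    · exact add_nonneg (h0 t) (mul_nonneg (hχ0 t) hτ)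
    · simp [hsupp t ht, hχsupp t ((min_le_right _ _).trans ht)]
    · simp only [htop t (ht.trans (min_le_left _ _)), hχtop t (ht.trans (min_le_right _ _))]
      push_cast
      ring
    · intro T hTm a ha' b hb'
      by_cases hex : ∃ t ∈ T, t < ε₂
      · have hlt := hT T hTm hex
        have e1 := htop a ((hlt a ha').le.trans (min_le_left _ _))
        have e2 := htop b ((hlt b hb').le.trans (min_le_left _ _))
        simp only [e1, e2]
        rw [add_sub_add_left_eq_sub, ← sub_mul, abs_mul, abs_of_nonneg hτ]
        refine mul_le_of_le_one_left hτ (abs_le.2 ⟨?_, ?_⟩) <;>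
          linarith [hχ0 a, hχ1 a, hχ0 b, hχ1 b]
      · push Not at hex
        have e1 := hχsupp a ((min_le_left _ _).trans (hex a ha'))
        have e2 := hχsupp b ((min_le_left _ _).trans (hex b hb'))
        simpa [e1, e2] using hosc T hTm a ha' b hb'

/-- A continuous bijection of the target of a chart that is the identity off a compact set extends
by the identity to a homeomorphism of the ambient compact space. -/
theorem OpenPartialHomeomorph.exists_homeomorph_extend {X E : Type*} [TopologicalSpace X]
    [T2Space X] [CompactSpace X] [TopologicalSpace E] (φ : OpenPartialHomeomorph X E)
    {K : Set E} (hK : IsCompact K) (hKt : K ⊆ φ.target) {H : E → E} (hc : Continuous H)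
    (hb : Bijective H) (hH : ∀ p ∉ K, H p = p) :
    ∃ h : X ≃ₜ X, (∀ x ∈ φ.source, h x = φ.symm (H (φ x))) ∧ ∀ x ∉ φ.source, h x = x := by
  classical
  have hmaps : ∀ p ∈ φ.target, H p ∈ φ.target := by
    intro p hp
    by_contra hcon
    have h1 : H (H p) = H p := hH _ fun h => hcon (hKt h)
    exact hcon (by rwa [hb.1 h1])
  have hlift : ∀ q ∈ φ.target, ∃ p ∈ φ.target, H p = q := by
    intro q hq
    obtain ⟨p, rfl⟩ := hb.2 q
    by_cases hp : p ∈ K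
    · exact ⟨p, hKt hp, rfl⟩
    · exact ⟨p, by rwa [hH p hp] at hq, rfl⟩
  set f : X → X := fun x => if x ∈ φ.source then φ.symm (H (φ x)) else x with hf
  have hfs : ∀ x ∈ φ.source, f x = φ.symm (H (φ x)) := fun x hx => if_pos hx
  have hfn : ∀ x ∉ φ.source, f x = x := fun x hx => if_neg hx
  have hfms : ∀ x, f x ∈ φ.source ↔ x ∈ φ.source := by
    intro x
    by_cases hx : x ∈ φ.source
    · simp only [hfs x hx, hx, iff_true]
      exact φ.map_target (hmaps _ (φ.map_source hx))
    · rw [hfn x hx]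
  have hKX : IsClosed (φ.symm '' K) :=
    (hK.image_of_continuousOn (φ.continuousOn_symm.mono hKt)).isClosed
  have hfoff : ∀ x ∈ (φ.symm '' K)ᶜ, f x = x := by
    intro x hx
    by_cases hxs : x ∈ φ.source
    · have : φ x ∉ K := fun h => hx ⟨φ x, h, φ.left_inv hxs⟩
      rw [hfs x hxs, hH _ this, φ.left_inv hxs]
    · exact hfn x hxs
  have hfc : Continuous f := by
    refine continuous_iff_continuousAt.2 fun x => ?_
    by_cases hx : x ∈ φ.source
    · have h1 : ContinuousOn (fun x => φ.symm (H (φ x))) φ.source :=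
        φ.continuousOn_symm.comp (hc.comp_continuousOn φ.continuousOn)
          fun y hy => hmaps _ (φ.map_source hy)
      exact (h1.congr hfs).continuousAt (φ.open_source.mem_nhds hx)
    · have hx' : x ∈ (φ.symm '' K)ᶜ := by
        rintro ⟨p, hp, rfl⟩
        exact hx (φ.map_target (hKt hp))
      exact (continuousOn_id.congr hfoff).continuousAt (hKX.isOpen_compl.mem_nhds hx')
  have hfb : Bijective f := by
    constructor
    · intro x y hxy
      by_cases hx : x ∈ φ.source
      · have hy : y ∈ φ.source := by rwa [← hfms, ← hxy, hfms]
        rw [hfs x hx, hfs y hy] at hxy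
        exact φ.injOn hx hy (hb.1 (φ.symm.injOn (hmaps _ (φ.map_source hx))
          (hmaps _ (φ.map_source hy)) hxy))
      · have hy : y ∉ φ.source := by rwa [← hfms, ← hxy, hfms]
        rwa [hfn x hx, hfn y hy] at hxy
    · intro y
      by_cases hy : y ∈ φ.source
      · obtain ⟨p, hp, hpy⟩ := hlift _ (φ.map_source hy)
        exact ⟨φ.symm p, by
          rw [hfs _ (φ.map_target hp), φ.right_inv hp, hpy, φ.left_inv hy]⟩
      · exact ⟨y, hfn y hy⟩
  exact ⟨Continuous.homeoOfEquivCompactToT2 (f := Equiv.ofBijective f hfb) hfc, hfs, hfn⟩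

/-- The members of a null family of closed sets disjoint from `A` which come close to the compact
set `A` are small and lie in a prescribed neighborhood of `A`. -/
theorem IsNullCollection.exists_open_superset {X : Type u} [MetricSpace X] [CompactSpace X]
    {𝒢 : Set (Set X)} (hnull : IsNullCollection 𝒢) {A : Set X} (hA : IsCompact A)
    (hcl : ∀ G ∈ 𝒢, G ≠ A → IsClosed G ∧ Disjoint G A) {V : Set X} (hV : IsOpen V) (hAV : A ⊆ V)
    {η : ℝ} (hη : 0 < η) :
    ∃ V', IsOpen V' ∧ A ⊆ V' ∧
      ∀ G ∈ 𝒢, G ≠ A → (G ∩ V').Nonempty → G ⊆ V ∧ diam G < η := by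
  obtain ⟨r, hr, hrV⟩ := hA.exists_thickening_subset_open hV hAV
  set F : Set (Set X) := {G | G ∈ 𝒢 ∧ min η (r / 2) ≤ diam G} \ {A} with hF
  have hFfin : F.Finite := (hnull _ (lt_min hη (half_pos hr))).sdiff
  have hFcl : IsClosed (⋃ G ∈ F, G) :=
    hFfin.isClosed_biUnion fun G hG => (hcl G hG.1.1 hG.2).1
  refine ⟨thickening (r / 2) A ∩ (⋃ G ∈ F, G)ᶜ, isOpen_thickening.inter hFcl.isOpen_compl,
    subset_inter (self_subset_thickening (half_pos hr) A) ?_, ?_⟩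
  · intro a ha hmem
    simp only [mem_iUnion] at hmem
    obtain ⟨G, hG, haG⟩ := hmem
    exact (hcl G hG.1.1 hG.2).2.le_bot ⟨haG, ha⟩
  · rintro G hG hGA ⟨x, hxG, hxA, hxF⟩
    have hsmall : diam G < min η (r / 2) := by
      by_contra! hle
      exact hxF (mem_biUnion (⟨⟨hG, hle⟩, hGA⟩ : G ∈ F) hxG)
    refine ⟨fun y hy => hrV ?_, hsmall.trans_le (min_le_left _ _)⟩
    rw [mem_thickening_iff] at hxA ⊢
    obtain ⟨a, ha, hxa⟩ := hxA
    have hyx : dist y x ≤ diam G :=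
      dist_le_diam_of_mem (hcl G hG hGA).1.isCompact.isBounded hy hxG
    refine ⟨a, ha, ?_⟩
    linarith [dist_triangle y x a, hsmall.trans_le (min_le_right η (r / 2))]

/-- A compact subset of a chart domain whose image is star-shaped about the origin is squeezable. -/
theorem squeezable_of_starConvex_image {X : Type u} [MetricSpace X] [CompactSpace X]
    {E : Type*} [NormedAddCommGroup E] [NormedSpace ℝ E] [ProperSpace E]
    (φ : OpenPartialHomeomorph X E) {A : Set X} (hAs : A ⊆ φ.source) (hBc : IsCompact (φ '' A))
    (h0 : (0 : E) ∈ φ '' A) (hstar : StarConvex ℝ 0 (φ '' A)) : Squeezable A := by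
  set B := φ '' A with hB
  have hBt : B ⊆ φ.target := by
    rintro _ ⟨a, ha, rfl⟩
    exact φ.map_source (hAs ha)
  have hBne : B.Nonempty := ⟨0, h0⟩
  have hA : IsCompact A := by
    have : φ.symm '' B = A := by
      rw [hB, image_image]
      exact (image_congr fun x hx => φ.left_inv (hAs hx)).trans (image_id' A)
    exact this ▸ hBc.image_of_continuousOn (φ.continuousOn_symm.mono hBt)
  refine ⟨hA, fun 𝒢 h𝒢 hnull hA𝒢 U hU hAU δ hδ => ?_⟩
  have hcl : ∀ G ∈ 𝒢, G ≠ A → IsClosed G ∧ Disjoint G A := by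
    intro G hG hGA
    refine ⟨(h𝒢.1 G hG).1.isClosed, Set.disjoint_left.2 fun x hxG hxA => hGA ?_⟩
    exact (h𝒢.2.1 x).unique ⟨hG, hxG⟩ ⟨hA𝒢, hxA⟩
  have hd : ∀ a ∈ A, infDist (φ a) B = 0 := fun a ha => infDist_zero_of_mem ⟨a, ha, rfl⟩
  have hsep : ∀ η > 0, ∀ ε > 0, ∃ ε' > 0, ∀ G ∈ 𝒢, G ≠ A →
      (∃ x ∈ G, x ∈ φ.source ∧ infDist (φ x) B < ε') →
      (∀ y ∈ G, y ∈ φ.source ∧ infDist (φ y) B < ε) ∧ diam G < η := by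
    intro η hη ε hε
    have hVo : IsOpen (φ.source ∩ φ ⁻¹' (thickening ε B)) :=
      φ.isOpen_inter_preimage isOpen_thickening
    obtain ⟨V', hV'o, hAV', hV'⟩ := hnull.exists_open_superset hA hcl hVo
      (fun a ha => ⟨hAs ha, self_subset_thickening hε B ⟨a, ha, rfl⟩⟩) hη
    obtain ⟨ε', hε', hsub⟩ := hBc.exists_thickening_subset_open
      (φ.isOpen_inter_preimage_symm hV'o) (by
        rintro _ ⟨a, ha, rfl⟩
        refine ⟨φ.map_source (hAs ha), ?_⟩
        rw [mem_preimage, φ.left_inv (hAs ha)]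
        exact hAV' ha)
    refine ⟨ε', hε', fun G hG hGA ⟨x, hxG, hxs, hxd⟩ => ?_⟩
    have hxV' : x ∈ V' := by
      have := (hsub ((mem_thickening_iff_infDist_lt hBne).2 hxd)).2
      rwa [mem_preimage, φ.left_inv hxs] at this
    obtain ⟨hGV, hdiam⟩ := hV' G hG hGA ⟨x, hxG, hxV'⟩
    exact ⟨fun y hy => ⟨(hGV hy).1, (mem_thickening_iff_infDist_lt hBne).1 (hGV hy).2⟩, hdiam⟩
  obtain ⟨ε₀, hε₀, hε₀U⟩ := hBc.exists_cthickening_subset_open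
    (φ.isOpen_inter_preimage_symm hU) (by
      rintro _ ⟨a, ha, rfl⟩
      refine ⟨φ.map_source (hAs ha), ?_⟩
      rw [mem_preimage, φ.left_inv (hAs ha)]
      exact hAU ha)
  set K := cthickening ε₀ B with hKdef
  have hK : IsCompact K := hBc.cthickening
  have hKt : K ⊆ φ.target := fun p hp => (hε₀U hp).1
  have hmemK : ∀ p, infDist p B ≤ ε₀ → p ∈ K := fun p hp =>
    mem_cthickening_iff.2 ((ENNReal.le_ofReal_iff_toReal_le (infEDist_ne_top hBne) hε₀.le).2 hp)
  obtain ⟨R, hRpos, hR⟩ : ∃ R > 0, ∀ p ∈ K, ‖p‖ ≤ R := hK.isBounded.exists_pos_norm_le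
  have hKX : IsCompact (φ.symm '' K) := hK.image_of_continuousOn (φ.continuousOn_symm.mono hKt)
  have hKXs : φ.symm '' K ⊆ φ.source := by
    rintro _ ⟨p, hp, rfl⟩
    exact φ.map_target (hKt hp)
  obtain ⟨δ', hδ', hsymm⟩ := Metric.uniformContinuousOn_iff.1
    (hK.uniformContinuousOn_of_continuous (φ.continuousOn_symm.mono hKt)) (δ / 2) (half_pos hδ)
  obtain ⟨η, hη, hunif⟩ := Metric.uniformContinuousOn_iff.1
    (hKX.uniformContinuousOn_of_continuous (φ.continuousOn.mono hKXs)) (δ' / 6) (by positivity)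
  obtain ⟨ε₁, hε₁, hε₁G⟩ := hsep η hη ε₀ hε₀
  set τ : ℝ := δ' / (4 * R ^ 2) with hτ
  have hτpos : 0 < τ := by positivity
  obtain ⟨k, hk⟩ := exists_nat_gt (2 / (δ' * τ))
  have hkτ : 2 < k * τ * δ' := by
    rw [div_lt_iff₀ (by positivity)] at hk
    linarith
  obtain ⟨σ, hσc, hσa, hσ0, hσsupp, ⟨ε₂, hε₂, hσtop⟩, hσosc⟩ :=
    exists_antitone_oscillation_le
      (𝒯 := {T | ∃ G ∈ 𝒢, G ⊆ φ.source ∧ T = (fun x => infDist (φ x) B) '' G}) (by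
        intro ε hε
        obtain ⟨ε', hε', h⟩ := hsep 1 one_pos ε hε
        refine ⟨ε', hε', ?_⟩
        rintro _ ⟨G, hG, hGs, rfl⟩ ⟨_, ⟨x, hx, rfl⟩, hxε⟩ _ ⟨y, hy, rfl⟩
        by_cases hGA : G = A
        · subst hGA
          simpa [hd y hy] using hε
        · exact ((h G hG hGA ⟨x, hx, hGs hx, hxε⟩).1 y hy).2) hτpos.le k
      (lt_min hε₀ hε₁)
  set s : E → ℝ := fun p => σ (infDist p B) with hs
  have hs0 : ∀ p, 0 ≤ s p := fun p => hσ0 _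
  have hsc : Continuous s := hσc.comp (continuous_infDist_pt B)
  have hsoff : ∀ p ∉ K, s p = 0 := by
    intro p hp
    refine hσsupp _ ((min_le_left _ _).trans ?_)
    by_contra! hlt
    exact hp (hmemK p hlt.le)
  have hsr : ∀ p, ∀ t : ℝ, 0 ≤ t → t ≤ 1 → s p ≤ s (t • p) := fun p t ht0 ht1 =>
    hσa (hstar.infDist_smul_le hBne ht0 ht1 p)
  set H := radialSqueeze s with hH
  have hHoff : ∀ p ∉ K, H p = p := fun p hp => radialSqueeze_of_eq_zero (hsoff p hp)
  have hHb : Bijective H := by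
    refine ⟨radialSqueeze_injective hs0 hsr, radialSqueeze_surjective hs0 hsc (R := R + 1) ?_⟩
    intro p hp
    refine hsoff p fun hpK => ?_
    linarith [hR p hpK]
  have hHK : ∀ p ∈ K, H p ∈ K := by
    intro p hp
    by_contra hcon
    have h1 : H (H p) = H p := hHoff _ hcon
    exact hcon (by rwa [hHb.1 h1])
  obtain ⟨h, hhs, hhn⟩ := φ.exists_homeomorph_extend hK hKt
    (continuous_radialSqueeze hs0 hsc) hHb hHoff
  have hhfix : ∀ x, (x ∈ φ.source → s (φ x) = 0) → h x = x := by
    intro x hx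
    by_cases hxs : x ∈ φ.source
    · rw [hhs x hxs, radialSqueeze_of_eq_zero (hx hxs), φ.left_inv hxs]
    · exact hhn x hxs
  have hdiam : ∀ G : Set X, (∀ x ∈ G, x ∈ φ.source ∧ φ x ∈ K) →
      (∀ x ∈ G, ∀ y ∈ G, dist (H (φ x)) (H (φ y)) < δ') → diam (h '' G) < δ := by
    intro G hG hdist
    refine (diam_le_of_forall_dist_le (half_pos hδ).le ?_).trans_lt (half_lt_self hδ)
    rintro _ ⟨x, hx, rfl⟩ _ ⟨y, hy, rfl⟩
    rw [hhs x (hG x hx).1, hhs y (hG y hy).1]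
    exact (hsymm _ (hHK _ (hG x hx).2) _ (hHK _ (hG y hy).2) (hdist x hx y hy)).le
  have hdiamA : diam (h '' A) < δ := by
    refine hdiam A (fun x hx => ⟨hAs hx, hmemK _ (by rw [hd x hx]; exact hε₀.le)⟩) ?_
    have hnorm : ∀ x ∈ A, ‖H (φ x)‖ < δ' / 2 := by
      intro x hx
      have h1 := mul_norm_radialSqueeze_le hs0 (φ x)
      have h2 : s (φ x) = k * τ := by
        simp only [hs, hd x hx]
        exact hσtop 0 hε₂.le
      rw [h2] at h1
      by_contra! hge
      have : k * τ * (δ' / 2) ≤ k * τ * ‖H (φ x)‖ := by gcongr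
      linarith
    intro x hx y hy
    linarith [dist_le_norm_add_norm (H (φ x)) (H (φ y)), hnorm x hx, hnorm y hy]
  refine ⟨h, fun x hxU => hhfix x fun hxs => hsoff _ fun hxK => hxU ?_, hdiamA, ?_⟩
  · have := (hε₀U hxK).2
    rwa [mem_preimage, φ.left_inv hxs] at this
  · intro G hG
    by_cases hGA : G = A
    · exact Or.inl (hGA ▸ hdiamA)
    by_cases hex : ∃ x ∈ G, x ∈ φ.source ∧ infDist (φ x) B < ε₁
    · left
      obtain ⟨hGs, hGdiam⟩ := hε₁G G hG hGA hex
      have hGK : ∀ x ∈ G, x ∈ φ.source ∧ φ x ∈ K := fun x hx =>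
        ⟨(hGs x hx).1, hmemK _ (hGs x hx).2.le⟩
      have hGKX : ∀ x ∈ G, x ∈ φ.symm '' K := fun x hx =>
        ⟨φ x, (hGK x hx).2, φ.left_inv (hGK x hx).1⟩
      refine hdiam G hGK fun x hx y hy => ?_
      have h1 : dist (φ x) (φ y) < δ' / 6 := hunif x (hGKX x hx) y (hGKX y hy)
        ((dist_le_diam_of_mem (h𝒢.1 G hG).1.isBounded hx hy).trans_lt hGdiam)
      have h2 : |s (φ x) - s (φ y)| ≤ τ :=
        hσosc _ ⟨G, hG, fun z hz => (hGK z hz).1, rfl⟩ _ ⟨x, hx, rfl⟩ _ ⟨y, hy, rfl⟩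
      have h3 : ‖φ x‖ ^ 2 * |s (φ x) - s (φ y)| ≤ R ^ 2 * τ := by
        gcongr
        exact hR _ (hGK x hx).2
      have h4 : R ^ 2 * τ = δ' / 4 := by
        rw [hτ]
        field_simp
      linarith [dist_radialSqueeze_le hs0 (φ x) (φ y)]
    · right
      push Not at hex
      exact fun x hx => hhfix x fun hxs => hσsupp _ ((min_le_right _ _).trans (hex x hx hxs))

/-- **Theorem 2.** Every starlike-equivalent subset of a compact metric space is
squeezable. -/
theorem starlikeEquivalent_squeezable {X : Type u} [MetricSpace X] [CompactSpace X]
    (A : Set X) (hA : IsStarlikeEquivalent A) : Squeezable A := by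
  obtain ⟨n, -, U, hU, hAU, e, he, heo, hcomp, c, hc, hseg⟩ := hA
  have hne : Nonempty U := by
    obtain ⟨u, -, -⟩ := hc
    exact ⟨u⟩
  let ψ : OpenPartialHomeomorph X (EuclideanSpace ℝ (Fin n)) :=
    (hU.isOpenEmbedding_subtypeVal.toOpenPartialHomeomorph Subtype.val).symm.trans
      (((Topology.IsOpenEmbedding.mk he heo).toOpenPartialHomeomorph e).transHomeomorph
        (Homeomorph.addRight (-c)))
  have hψs : ψ.source = U := by
    simp [ψ]
  have hψ : ∀ u : U, ψ u = e u - c := by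
    intro u
    have : (hU.isOpenEmbedding_subtypeVal.toOpenPartialHomeomorph Subtype.val).symm (u : X) = u :=
      (hU.isOpenEmbedding_subtypeVal.toOpenPartialHomeomorph Subtype.val).left_inv (by simp)
    simp [ψ, this, sub_eq_add_neg]
  have himage : ψ '' A = (fun p => p - c) '' (e '' {x : U | (x : X) ∈ A}) := by
    ext p
    constructor
    · rintro ⟨a, ha, rfl⟩
      exact ⟨e ⟨a, hAU ha⟩, ⟨⟨a, hAU ha⟩, ha, rfl⟩, (hψ ⟨a, hAU ha⟩).symm⟩
    · rintro ⟨_, ⟨u, hu, rfl⟩, rfl⟩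
      exact ⟨u, hu, hψ u⟩
  refine squeezable_of_starConvex_image ψ (hAU.trans hψs.ge) ?_ ?_ ?_
  · rw [himage]
    exact hcomp.image (continuous_id.sub continuous_const)
  · rw [himage]
    exact ⟨c, hc, sub_self c⟩
  · rw [himage, starConvex_zero_iff]
    rintro _ ⟨y, hy, rfl⟩ t ht0 ht1
    refine ⟨c + t • (y - c), hseg y hy ?_, by simp⟩
    rw [segment_eq_image']
    exact ⟨t, ⟨ht0, ht1⟩, rfl⟩
end

section
/- If A is a squeezable subset of a compact metric space X, then A is a squashable subset of X. -/
open Metric Set Function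

universe u v

open Filter Topology

/-- One step of the squeezing process: a homeomorphism `F` is modified near the squeezable set
`A` so that the image of `A` becomes `ε`-small, without moving any image by more than `3 * η`,
where `η` bounds the size of the image of `A` under `F`. -/
lemma Squeezable.exists_step {X : Type u} [MetricSpace X] [CompactSpace X] {A : Set X}
    (hA : Squeezable A) {𝒢 : Set (Set X)} (h𝒢 : IsUSCDecomposition 𝒢)
    (hnull : IsNullCollection 𝒢) (hA𝒢 : A ∈ 𝒢) (F : X ≃ₜ X) {r η ε : ℝ} (hr : 0 < r)
    (hη : 0 < η) (hε : 0 < ε) (hFA : ∀ a ∈ A, ∀ b ∈ A, dist (F a) (F b) ≤ η) :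
    ∃ (F' : X ≃ₜ X) (r' : ℝ), 0 < r' ∧ r' ≤ r / 2 ∧
      (∀ x ∉ thickening r' A, F' x = F x) ∧ (∀ x, dist (F x) (F' x) ≤ 3 * η) ∧
      (∀ a ∈ A, ∀ b ∈ A, dist (F' a) (F' b) ≤ ε) ∧
      ∀ G ∈ 𝒢, (∀ a ∈ G, ∀ b ∈ G, dist (F' a) (F' b) ≤ ε) ∨ ∀ x ∈ G, F' x = F x := by
  have hF := CompactSpace.uniformContinuous_of_continuous F.continuous
  obtain ⟨s, hs, hFs⟩ := Metric.uniformContinuous_iff.1 hF η hη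
  obtain ⟨t, ht, hFt⟩ := Metric.uniformContinuous_iff.1 hF ε hε
  have hr' : 0 < min (r / 2) s := lt_min (half_pos hr) hs
  obtain ⟨g, hg, hgA, hgG⟩ := hA.2 𝒢 h𝒢 hnull hA𝒢 (thickening (min (r / 2) s) A)
    isOpen_thickening (self_subset_thickening hr' A) t ht
  have small {G : Set X} (hG : Metric.diam (⇑g '' G) < t) :
      ∀ a ∈ G, ∀ b ∈ G, dist (F (g a)) (F (g b)) ≤ ε := fun a ha b hb =>
    (hFt ((dist_le_diam_of_mem isBounded_of_compactSpace (mem_image_of_mem g ha)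
      (mem_image_of_mem g hb)).trans_lt hG)).le
  have near {x : X} (hx : x ∈ thickening (min (r / 2) s) A) : ∃ a ∈ A, dist (F x) (F a) < η := by
    obtain ⟨a, ha, hxa⟩ := mem_thickening_iff.1 hx
    exact ⟨a, ha, hFs (hxa.trans_le (min_le_right _ _))⟩
  refine ⟨g.trans F, min (r / 2) s, hr', min_le_left _ _, fun x hx => ?_, fun x => ?_,
    small hgA, fun G hG => (hgG G hG).imp small fun h x hx => ?_⟩
  · simp [hg x hx]
  · by_cases hx : x ∈ thickening (min (r / 2) s) A
    · have hgx : g x ∈ thickening (min (r / 2) s) A := by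
        by_contra h
        rw [g.injective (hg _ h)] at h
        exact h hx
      obtain ⟨a, ha, hxa⟩ := near hx
      obtain ⟨b, hb, hxb⟩ := near hgx
      have h₁ := dist_triangle4 (F x) (F a) (F b) (F (g x))
      have h₂ := hFA a ha b hb
      rw [dist_comm (F b)] at h₁
      simp only [Homeomorph.trans_apply]
      linarith
    · simp only [Homeomorph.trans_apply, hg x hx, dist_self]
      positivity
  · simp [h x hx]

/-- Iterating `Squeezable.exists_step` gives a sequence of homeomorphisms that shrink `A` to a
point and whose supports relative to one another shrink down to `A`. -/
lemma Squeezable.exists_seq {X : Type u} [MetricSpace X] [CompactSpace X] {A : Set X}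
    (hA : Squeezable A) {𝒢 : Set (Set X)} (h𝒢 : IsUSCDecomposition 𝒢)
    (hnull : IsNullCollection 𝒢) (hA𝒢 : A ∈ 𝒢) {U : Set X} (hU : IsOpen U) (hAU : A ⊆ U)
    {δ : ℝ} (hδ : 0 < δ) :
    ∃ (C : ℝ) (F : ℕ → X ≃ₜ X) (r : ℕ → ℝ),
      (∀ n, 0 < r n ∧ r (n + 1) ≤ r n / 2) ∧
      (∀ n, ∀ x ∈ Uᶜ, F n x = x) ∧
      (∀ n, ∀ x ∉ thickening (r (n + 1)) A, F (n + 1) x = F n x) ∧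
      (∀ n x, dist (F n x) (F (n + 1) x) ≤ 3 * (C / 2 ^ n)) ∧
      (∀ n, ∀ a ∈ A, ∀ b ∈ A, dist (F n a) (F n b) ≤ C / 2 ^ n) ∧
      ∀ n, ∀ G ∈ 𝒢, (∀ a ∈ G, ∀ b ∈ G, dist (F n a) (F n b) ≤ δ) ∨ ∀ x ∈ G, F n x = x := by
  set C := Metric.diam (univ : Set X) + 1
  have hC : 0 < C := by positivity
  let P (n : ℕ) (s : (X ≃ₜ X) × ℝ) : Prop := 0 < s.2 ∧ thickening s.2 A ⊆ U ∧
    (∀ x ∈ Uᶜ, s.1 x = x) ∧ (∀ a ∈ A, ∀ b ∈ A, dist (s.1 a) (s.1 b) ≤ C / 2 ^ n) ∧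
    ∀ G ∈ 𝒢, (∀ a ∈ G, ∀ b ∈ G, dist (s.1 a) (s.1 b) ≤ δ) ∨ ∀ x ∈ G, s.1 x = x
  have init : ∃ s, P 0 s := by
    obtain ⟨r, hr, hrU⟩ := hA.1.exists_thickening_subset_open hU hAU
    refine ⟨(Homeomorph.refl X, r), hr, hrU, fun _ _ => rfl, fun a _ b _ => ?_,
      fun _ _ => Or.inr fun _ _ => rfl⟩
    have := dist_le_diam_of_mem isBounded_of_compactSpace (mem_univ a) (mem_univ b)
    simp only [Homeomorph.refl_apply, id, pow_zero, div_one, C]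
    linarith
  have step (n : ℕ) (s : {s // P n s}) : ∃ s' : {s // P (n + 1) s}, s'.1.2 ≤ s.1.2 / 2 ∧
      (∀ x ∉ thickening s'.1.2 A, s'.1.1 x = s.1.1 x) ∧
      ∀ x, dist (s.1.1 x) (s'.1.1 x) ≤ 3 * (C / 2 ^ n) := by
    obtain ⟨⟨F, r⟩, hr, hrU, hFU, hFA, hFG⟩ := s
    obtain ⟨F', r', hr', hrr', hoff, hdist, hA', hG'⟩ := hA.exists_step h𝒢 hnull hA𝒢 F hr
      (η := C / 2 ^ n) (ε := min (C / 2 ^ (n + 1)) δ) (by positivity) (by positivity) hFA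
    have hsub : thickening r' A ⊆ U :=
      (thickening_mono (hrr'.trans (half_le_self (le_of_lt hr))) A).trans hrU
    refine ⟨⟨(F', r'), hr', hsub, fun x hx => ?_,
      fun a ha b hb => (hA' a ha b hb).trans (min_le_left _ _), fun G hG => ?_⟩,
      hrr', hoff, hdist⟩
    · exact (hoff x fun h => hx (hsub h)).trans (hFU x hx)
    · rcases hG' G hG with h | h
      · exact Or.inl fun a ha b hb => (h a ha b hb).trans (min_le_right _ _)
      · refine (hFG G hG).imp (fun h' a ha b hb => ?_) fun h' x hx => (h x hx).trans (h' x hx)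
        simpa only [h a ha, h b hb] using h' a ha b hb
  choose next hnext using step
  let S (n : ℕ) : {s // P n s} := Nat.rec ⟨init.choose, init.choose_spec⟩ next n
  refine ⟨C, fun n => (S n).1.1, fun n => (S n).1.2,
    fun n => ⟨(S n).2.1, (hnext n (S n)).1⟩, fun n => (S n).2.2.2.1,
    fun n => (hnext n (S n)).2.1, fun n => (hnext n (S n)).2.2, fun n => (S n).2.2.2.2.1,
    fun n => (S n).2.2.2.2.2⟩

/-- If two injective maps agree off `W` and the first is surjective, then the image of `W` under
the second lies in the image of `W` under the first. -/
lemma image_subset_image_of_eqOn_compl {X : Type u} {Y : Type v} {F F' : X → Y} {W : Set X}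
    (hF : Surjective F) (hF' : Injective F') (h : ∀ x ∉ W, F' x = F x) : F' '' W ⊆ F '' W := by
  rintro _ ⟨x, hx, rfl⟩
  obtain ⟨z, hz⟩ := hF (F' x)
  refine ⟨z, ?_, hz⟩
  by_contra hzW
  rw [← h z hzW] at hz
  exact hzW (hF' hz ▸ hx)

/-- A continuous surjection between compact Hausdorff spaces restricts to a homeomorphism off a
fiber off which it is injective. -/
lemma mapsHomeomorphicallyOnto_compl {X : Type u} {Y : Type v} [TopologicalSpace X]
    [CompactSpace X] [TopologicalSpace Y] [T2Space Y] {f : X → Y} (hf : Continuous f)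
    (hsurj : Surjective f) {A : Set X} {p : Y} (hA : f ⁻¹' {p} = A) (hinj : InjOn f Aᶜ) :
    MapsHomeomorphicallyOnto f Aᶜ {p}ᶜ := by
  subst hA
  have hcont : Continuous (({p}ᶜ : Set Y).restrictPreimage f) := hf.restrictPreimage
  have hclosed : IsClosedMap (({p}ᶜ : Set Y).restrictPreimage f) :=
    hf.isClosedMap.restrictPreimage _
  have hbij : Bijective (({p}ᶜ : Set Y).restrictPreimage f) :=
    ⟨fun x y h => Subtype.ext (hinj x.2 y.2 (congrArg Subtype.val h)),
      Set.restrictPreimage_surjective _ hsurj⟩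
  exact ⟨(Equiv.ofBijective _ hbij).toHomeomorphOfContinuousClosed hcont hclosed, fun _ => rfl⟩

/-- **Theorem 3, forward direction.** Every squeezable subset of a compact metric space
is squashable. -/
theorem squeezable_imp_squashable {X : Type u} [MetricSpace X] [CompactSpace X]
    (A : Set X) (hA : Squeezable A) : Squashable A := by
  refine ⟨hA.1, fun 𝒢 h𝒢 hnull hA𝒢 U hU hAU δ hδ => ?_⟩
  obtain ⟨C, F, r, hr, hFU, hFoff, hFdist, hFA, hFG⟩ :=
    hA.exists_seq h𝒢 hnull hA𝒢 hU hAU (half_pos hδ)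
  have hC (n : ℕ) : 0 ≤ C / 2 ^ n := by
    obtain ⟨a, ha⟩ := (h𝒢.1 A hA𝒢).2
    exact dist_nonneg.trans (hFA n a ha a ha)
  have hcauchy : CauchySeq fun n => (F n : C(X, X)) := by
    refine cauchySeq_of_le_geometric_two (C := 6 * C) fun n => ?_
    have hn := hC n
    have h : 6 * C / 2 / 2 ^ n = 3 * (C / 2 ^ n) := by ring
    rw [h, ContinuousMap.dist_le (by positivity)]
    exact hFdist n
  obtain ⟨f, hf⟩ := cauchySeq_tendsto_of_complete hcauchy
  have hfx (x : X) : Tendsto (fun n => F n x) atTop (𝓝 (f x)) :=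
    ((continuous_eval_const x).tendsto f).comp hf
  have hrlim : Tendsto r atTop (𝓝 0) := by
    have hle (n : ℕ) : r n ≤ r 0 * (1 / 2) ^ n := by
      induction n with
      | zero => simp
      | succ n ih => rw [pow_succ]; linarith [(hr n).2]
    refine squeeze_zero (fun n => (hr n).1.le) hle ?_
    simpa using (tendsto_pow_atTop_nhds_zero_of_lt_one (r := (1 / 2 : ℝ)) (by norm_num)
      (by norm_num)).const_mul (r 0)
  have hanti : Antitone r := antitone_nat_of_succ_le fun n => by linarith [hr n]
  have hstable {n : ℕ} {x : X} (hx : x ∉ thickening (r (n + 1)) A) {m : ℕ} (hm : n ≤ m) :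
      F m x = F n x := by
    induction m, hm using Nat.le_induction with
    | base => rfl
    | succ m hm ih =>
      exact (hFoff m x fun h => hx (thickening_mono (hanti (by omega)) A h)).trans ih
  have heq {n : ℕ} {x : X} (hx : x ∉ thickening (r (n + 1)) A) : f x = F n x :=
    tendsto_nhds_unique (hfx x)
      (tendsto_const_nhds.congr' ((eventually_ge_atTop n).mono fun m hm => (hstable hx hm).symm))
  have hescape {x : X} (hx : x ∉ A) : ∀ᶠ n in atTop, x ∉ cthickening (r (n + 1)) A := by
    have hpos : 0 < infDist x A :=
      (hA.1.isClosed.notMem_iff_infDist_pos (h𝒢.1 A hA𝒢).2).1 hx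
    filter_upwards [hrlim.eventually_lt_const hpos] with n hn h
    have h' := cthickening_subset_thickening' (hr n).1 (by linarith [hr n]) A h
    rw [mem_thickening_iff_infDist_lt (h𝒢.1 A hA𝒢).2] at h'
    exact lt_asymm h' hn
  obtain ⟨a, ha⟩ := (h𝒢.1 A hA𝒢).2
  have hfA {x : X} (hx : x ∈ A) : f x = f a := by
    refine dist_le_zero.1 (le_of_tendsto_of_tendsto' ((hfx x).dist (hfx a)) ?_
      fun n => hFA n x hx a ha)
    have := (tendsto_pow_atTop_nhds_zero_of_lt_one (r := (1 / 2 : ℝ)) (by norm_num)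
      (by norm_num)).const_mul C
    simpa [div_eq_mul_inv] using this
  have hne {x : X} (hx : x ∉ A) : f x ≠ f a := by
    obtain ⟨n, hn⟩ := (hescape hx).exists
    have hmem : f a ∈ F n '' cthickening (r (n + 1)) A := by
      refine (isClosed_cthickening.isCompact.image (F n).continuous).isClosed.mem_of_tendsto
        (hfx a) ((eventually_ge_atTop n).mono fun m hm => ?_)
      refine image_mono (thickening_subset_cthickening _ A)
        (image_subset_image_of_eqOn_compl (F n).surjective (F m).injective
          (fun y hy => hstable hy hm) ?_)
      exact mem_image_of_mem _ (self_subset_thickening (hr _).1 A ha)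
    rw [heq fun h => hn (thickening_subset_cthickening _ A h)]
    rintro h
    rw [← h] at hmem
    exact hn ((F n).injective.mem_set_image.1 hmem)
  have hinj : InjOn f Aᶜ := by
    intro x hx y hy hxy
    obtain ⟨n, hxn, hyn⟩ := ((hescape hx).and (hescape hy)).exists
    rw [heq fun h => hxn (thickening_subset_cthickening _ A h),
      heq fun h => hyn (thickening_subset_cthickening _ A h)] at hxy
    exact (F n).injective hxy
  have hsurj : Surjective f := by
    rw [← range_eq_univ, ← (isCompact_range f.continuous).isClosed.closure_eq, eq_univ_iff_forall]
    intro y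
    refine Metric.mem_closure_iff.2 fun ε hε => ?_
    obtain ⟨n, hn⟩ := (Metric.tendsto_nhds.1 hf ε hε).exists
    refine ⟨f ((F n).symm y), mem_range_self _, ?_⟩
    simpa using (ContinuousMap.dist_apply_le_dist ((F n).symm y)).trans_lt hn
  refine ⟨f, f a, mem_closure_of_tendsto hf (Eventually.of_forall fun n => ⟨F n, hFU n, rfl⟩),
    ?_, mapsHomeomorphicallyOnto_compl f.continuous hsurj ?_ hinj, fun G hG => ?_⟩
  · exact Subset.antisymm (image_subset_iff.2 fun x hx => hfA hx)
      (singleton_subset_iff.2 (mem_image_of_mem f ha))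
  · ext x
    exact ⟨fun h => by_contra fun hx => hne hx h, hfA⟩
  · by_cases h : ∃ᶠ n in atTop, ∀ x ∈ G, ∀ y ∈ G, dist (F n x) (F n y) ≤ δ / 2
    · refine Or.inl ((diam_le_of_forall_dist_le (half_pos hδ).le ?_).trans_lt (half_lt_self hδ))
      rintro _ ⟨x, hx, rfl⟩ _ ⟨y, hy, rfl⟩
      exact le_of_tendsto_of_frequently ((hfx x).dist (hfx y))
        (h.mono fun n hn => hn x hx y hy)
    · refine Or.inr fun x hx => tendsto_nhds_unique (hfx x) (tendsto_const_nhds.congr' ?_)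
      filter_upwards [not_frequently.1 h] with n hn
      exact (((hFG n G hG).resolve_left hn) x hx).symm
end

section
/- If A is a squashable subset of a compact metric space X, then A is a squeezable subset of X. -/
open Metric Set Function

universe u v

/-- If `h` is `ε`-close to `f`, it increases the diameter of an image by at most `2ε`. -/
theorem diam_image_le_of_dist_le {X : Type u} {Y : Type v} [PseudoMetricSpace Y]
    {f h : X → Y} {S : Set X} {ε : ℝ} (hε : 0 ≤ ε) (hS : Bornology.IsBounded (f '' S))
    (hfh : ∀ x ∈ S, dist (h x) (f x) ≤ ε) :
    Metric.diam (h '' S) ≤ Metric.diam (f '' S) + 2 * ε := by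
  refine Metric.diam_le_of_forall_dist_le (add_nonneg Metric.diam_nonneg (by linarith)) ?_
  rintro _ ⟨x, hx, rfl⟩ _ ⟨y, hy, rfl⟩
  have hxy := Metric.dist_le_diam_of_mem hS (mem_image_of_mem f hx) (mem_image_of_mem f hy)
  have htri := dist_triangle4 (h x) (f x) (f y) (h y)
  have hx' := hfh x hx
  have hy' := hfh y hy
  rw [dist_comm] at hy'
  linarith

/-- The defining property of squeezability, by induction on a bound for the number of large
members of the decomposition that meet `U`: whenever the squashing map fixes such a member,
that member is removed from `U`. -/
theorem Squashable.exists_homeomorph {X : Type u} [MetricSpace X] [CompactSpace X]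
    {A : Set X} (hA : Squashable A) {𝒢 : Set (Set X)} (h𝒢 : IsUSCDecomposition 𝒢)
    (hnull : IsNullCollection 𝒢) (hA𝒢 : A ∈ 𝒢) {δ : ℝ} (hδ : 0 < δ) (n : ℕ) :
    ∀ U : Set X, IsOpen U → A ⊆ U →
      {G | G ∈ 𝒢 ∧ δ / 2 ≤ Metric.diam G ∧ ¬ G ⊆ Uᶜ}.ncard < n →
      ∃ h : X ≃ₜ X, (∀ x ∈ Uᶜ, h x = x) ∧ Metric.diam (⇑h '' A) < δ ∧
        ∀ G ∈ 𝒢, Metric.diam (⇑h '' G) < δ ∨ ∀ x ∈ G, h x = x := by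
  induction n with
  | zero => intro U _ _ hn; omega
  | succ n ih =>
    intro U hU hAU hn
    obtain ⟨f, p, hf, hfA, -, hfG⟩ := hA.2 𝒢 h𝒢 hnull hA𝒢 U hU hAU (δ / 2) (half_pos hδ)
    by_cases hbig : ∃ G ∈ 𝒢, δ / 2 ≤ Metric.diam G ∧ ¬ G ⊆ Uᶜ ∧ ∀ x ∈ G, f x = x
    · obtain ⟨G, hG, hGdiam, hGU, hGf⟩ := hbig
      have hGA : G ≠ A := by
        rintro rfl
        rw [image_congr hGf, image_id'] at hfA
        rw [hfA, Metric.diam_singleton] at hGdiam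
        linarith
      have hAG : A ⊆ U \ G := fun x hx =>
        ⟨hAU hx, fun hxG => hGA ((h𝒢.2.1 x).unique ⟨hG, hxG⟩ ⟨hA𝒢, hx⟩)⟩
      have hfin : {G | G ∈ 𝒢 ∧ δ / 2 ≤ Metric.diam G ∧ ¬ G ⊆ Uᶜ}.Finite :=
        (hnull (δ / 2) (half_pos hδ)).subset fun H hH => ⟨hH.1, hH.2.1⟩
      have hmono : Uᶜ ⊆ (U \ G)ᶜ := compl_subset_compl.2 sdiff_subset
      have hlt : {H | H ∈ 𝒢 ∧ δ / 2 ≤ Metric.diam H ∧ ¬ H ⊆ (U \ G)ᶜ}.ncard <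
          {H | H ∈ 𝒢 ∧ δ / 2 ≤ Metric.diam H ∧ ¬ H ⊆ Uᶜ}.ncard := by
        refine ncard_lt_ncard ((ssubset_iff_of_subset ?_).2 ⟨G, ⟨hG, hGdiam, hGU⟩, ?_⟩) hfin
        · exact fun H hH => ⟨hH.1, hH.2.1, fun h => hH.2.2 (h.trans hmono)⟩
        · exact fun h => h.2.2 fun x hx hxU => hxU.2 hx
      obtain ⟨h, hhU, hh⟩ := ih (U \ G) (hU.sdiff (h𝒢.1 G hG).1.isClosed) hAG (by omega)
      exact ⟨h, fun x hx => hhU x (hmono hx), hh⟩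
    · push Not at hbig
      obtain ⟨_, ⟨h, hhU, rfl⟩, hfh⟩ := Metric.mem_closure_iff.1 hf (δ / 8) (by linarith)
      have hsmall : ∀ S : Set X, Metric.diam (f '' S) < δ / 2 → Metric.diam (h '' S) < δ := by
        intro S hS
        have := diam_image_le_of_dist_le (f := f) (h := h) (S := S) (ε := δ / 8) (by linarith)
          (isCompact_univ.isBounded.subset (subset_univ _)) fun x _ => by
            rw [dist_comm]
            exact (ContinuousMap.dist_apply_le_dist x).trans hfh.le
        linarith
      refine ⟨h, hhU, hsmall A (by rw [hfA, Metric.diam_singleton]; linarith), fun G hG => ?_⟩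
      rcases hfG G hG with hd | hid
      · exact Or.inl (hsmall G hd)
      rcases lt_or_ge (Metric.diam G) (δ / 2) with hd | hd
      · refine Or.inl (hsmall G ?_)
        rwa [image_congr hid, image_id']
      · refine Or.inr fun x hx => hhU x ?_
        by_contra hxU
        obtain ⟨y, hy, hfy⟩ := hbig G hG hd fun h => hxU (h hx)
        exact hfy (hid y hy)

/-- **Theorem 3, reverse direction.** Every squashable subset of a compact metric space
is squeezable. -/
theorem squashable_imp_squeezable {X : Type u} [MetricSpace X] [CompactSpace X]
    (A : Set X) (hA : Squashable A) : Squeezable A := by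
  exact ⟨hA.1, fun _ h𝒢 hnull hA𝒢 U hU hAU _ hδ =>
    hA.exists_homeomorph h𝒢 hnull hA𝒢 hδ _ U hU hAU (Nat.lt_succ_self _)⟩
end

section
/- Let B ⊆ A be compact subsets of a compact metric space X. If B is a squashable subset of X and the image A/B of A in the quotient space X/B is a squashable subset of X/B (with respect to some metric inducing the quotient topology), then A is a squashable subset of X. -/
open Metric Set Function

universe u v

/-- In a compact metric space, a null partition into nonempty compact sets is upper
semi-continuous. -/
theorem isUSCDecomposition_of_isNullCollection {X : Type u} [MetricSpace X] {𝒢 : Set (Set X)}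
    (hc : ∀ G ∈ 𝒢, IsCompact G ∧ G.Nonempty) (hp : ∀ x : X, ∃! G, G ∈ 𝒢 ∧ x ∈ G)
    (hn : IsNullCollection 𝒢) : IsUSCDecomposition 𝒢 := by
  refine ⟨hc, hp, fun C hC => ?_⟩
  set r : X → X → Prop := fun x y : X => ∃ G ∈ 𝒢, x ∈ G ∧ y ∈ G with hr
  have hequiv : Equivalence r := by
    refine ⟨fun x => ?_, ?_, ?_⟩
    · obtain ⟨G, ⟨hG, hx⟩, -⟩ := hp x
      exact ⟨G, hG, hx, hx⟩
    · rintro x y ⟨G, hG, hx, hy⟩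
      exact ⟨G, hG, hy, hx⟩
    · rintro x y z ⟨G, hG, hx, hy⟩ ⟨G', hG', hy', hz⟩
      obtain rfl := (hp y).unique ⟨hG, hy⟩ ⟨hG', hy'⟩
      exact ⟨G, hG, hx, hz⟩
  have hmk : ∀ x y : X, Quot.mk r x = Quot.mk r y ↔ r x y := fun x y =>
    ⟨fun h => hequiv.eqvGen_iff.1 (Quot.eqvGen_exact h), fun h => Quot.sound h⟩
  rw [← isQuotientMap_quot_mk.isClosed_preimage, ← isOpen_compl_iff, Metric.isOpen_iff]
  intro x hx
  have hsat : ∀ y, y ∈ Quot.mk r ⁻¹' (Quot.mk r '' C) ↔ ∃ c ∈ C, r c y := by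
    intro y
    simp only [mem_preimage, mem_image, hmk]
  have hxC : x ∈ Cᶜ := fun h => hx ((hsat x).2 ⟨x, h, hequiv.refl x⟩)
  obtain ⟨ε, hε, hball⟩ := Metric.isOpen_iff.1 hC.isOpen_compl x hxC
  set F : Set (Set X) := {G | G ∈ 𝒢 ∧ ε / 2 ≤ Metric.diam G} ∩ {G | (G ∩ C).Nonempty} with hF
  have hFfin : F.Finite := (hn (ε / 2) (by positivity)).subset inter_subset_left
  have hFclosed : IsClosed (⋃ G ∈ F, G) :=
    hFfin.isClosed_biUnion fun G hG => (hc G hG.1.1).1.isClosed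
  have hxF : x ∈ (⋃ G ∈ F, G)ᶜ := by
    simp only [mem_compl_iff, mem_iUnion, not_exists]
    rintro G ⟨⟨hG, -⟩, c, hcG, hcC⟩ hxG
    exact hx ((hsat x).2 ⟨c, hcC, G, hG, hcG, hxG⟩)
  obtain ⟨η, hη, hball'⟩ := Metric.isOpen_iff.1 hFclosed.isOpen_compl x hxF
  refine ⟨min (ε / 2) η, by positivity, fun y hy hyC => ?_⟩
  obtain ⟨c, hcC, G, hG, hcG, hyG⟩ := (hsat y).1 hyC
  have hyx : dist y x < ε / 2 := lt_of_lt_of_le hy (min_le_left _ _)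
  have hyF := hball' (Metric.mem_ball.2 (lt_of_lt_of_le hy (min_le_right _ _)))
  have hd : Metric.diam G < ε / 2 := by
    by_contra! hd
    exact hyF (mem_biUnion (show G ∈ F from ⟨⟨hG, hd⟩, c, hcG, hcC⟩) hyG)
  have hcy := Metric.dist_le_diam_of_mem (hc G hG).1.isBounded hcG hyG
  refine hball (Metric.mem_ball.2 ?_) hcC
  linarith [dist_triangle c y x]

/-- A uniformly continuous map sends bounded sets of small diameter to sets of small diameter. -/
theorem exists_diam_image_lt {X : Type u} {Y : Type v} [MetricSpace X] [CompactSpace X]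
    [MetricSpace Y] {f : X → Y} (hf : Continuous f) {ε : ℝ} (hε : 0 < ε) :
    ∃ δ > 0, ∀ S : Set X, Metric.diam S < δ → Metric.diam (f '' S) < ε := by
  obtain ⟨δ, hδ, h⟩ := Metric.uniformContinuous_iff.1
    (CompactSpace.uniformContinuous_of_continuous hf) (ε / 2) (by positivity)
  refine ⟨δ, hδ, fun S hS => lt_of_le_of_lt
    (Metric.diam_le_of_forall_dist_le (by positivity) ?_) (half_lt_self hε)⟩
  rintro _ ⟨x, hx, rfl⟩ _ ⟨y, hy, rfl⟩
  exact (h (lt_of_le_of_lt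
    (Metric.dist_le_diam_of_mem (isCompact_univ.isBounded.subset (subset_univ S)) hx hy) hS)).le

/-- The image of a null decomposition under a continuous surjection whose only possibly
nondegenerate fiber lies in a member of the decomposition. -/
theorem image_decomposition {X : Type u} {Y : Type v} [MetricSpace X] [CompactSpace X]
    [MetricSpace Y] {π : X → Y} (hπ : Continuous π) (hsurj : Surjective π) {A B : Set X}
    (hBA : B ⊆ A) (hfib : ∀ x y : X, π x = π y ↔ x = y ∨ (x ∈ B ∧ y ∈ B)) {𝒢 : Set (Set X)}
    (hG : IsUSCDecomposition 𝒢) (hn : IsNullCollection 𝒢) (hA : A ∈ 𝒢) :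
    IsUSCDecomposition (image π '' 𝒢) ∧ IsNullCollection (image π '' 𝒢) := by
  have hnull : IsNullCollection (image π '' 𝒢) := by
    intro ε hε
    obtain ⟨δ, hδ, h⟩ := exists_diam_image_lt hπ hε
    refine ((hn δ hδ).image (image π)).subset ?_
    rintro _ ⟨⟨G, hG, rfl⟩, hd⟩
    exact ⟨G, ⟨hG, not_lt.1 fun hlt => (h G hlt).not_ge hd⟩, rfl⟩
  refine ⟨isUSCDecomposition_of_isNullCollection ?_ ?_ hnull, hnull⟩
  · rintro _ ⟨G, hGG, rfl⟩
    exact ⟨(hG.1 G hGG).1.image hπ, (hG.1 G hGG).2.image π⟩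
  · intro y
    obtain ⟨x, rfl⟩ := hsurj y
    obtain ⟨G, ⟨hGG, hx⟩, hu⟩ := hG.2.1 x
    refine ⟨π '' G, ⟨⟨G, hGG, rfl⟩, x, hx, rfl⟩, ?_⟩
    rintro _ ⟨⟨G', hG', rfl⟩, x', hx', he⟩
    obtain rfl | ⟨hxB', hxB⟩ := (hfib x' x).1 he
    · rw [hu G' ⟨hG', hx'⟩]
    · rw [← hu A ⟨hA, hBA hxB⟩, (hG.2.1 x').unique ⟨hG', hx'⟩ ⟨hA, hBA hxB'⟩]

/-- A map collapsing exactly `A` to `p` and mapping the complement homeomorphically is a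
surjection whose fibers are `A` and singletons. -/
theorem MapsHomeomorphicallyOnto.surjective_and_fibers {X : Type u} {Y : Type v}
    [TopologicalSpace X] [TopologicalSpace Y] {f : X → Y} {A : Set X} {p : Y}
    (h : MapsHomeomorphicallyOnto f Aᶜ {p}ᶜ) (hA : f '' A = {p}) :
    Surjective f ∧ ∀ x y : X, f x = f y ↔ x = y ∨ (x ∈ A ∧ y ∈ A) := by
  obtain ⟨e, he⟩ := h
  have hin : ∀ x ∈ A, f x = p := fun x hx => by
    have : f x ∈ f '' A := ⟨x, hx, rfl⟩
    rwa [hA] at this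
  have hout : ∀ x ∉ A, f x ≠ p := fun x hx => by
    rw [← he ⟨x, hx⟩]
    exact (e ⟨x, hx⟩).2
  refine ⟨fun y => ?_, fun x y => ⟨fun hxy => ?_, ?_⟩⟩
  · by_cases hy : y = p
    · have : y ∈ f '' A := by rw [hA]; exact hy
      obtain ⟨x, -, hx⟩ := this
      exact ⟨x, hx⟩
    · exact ⟨e.symm ⟨y, hy⟩, by rw [← he]; simp⟩
  · by_cases hx : x ∈ A
    · by_cases hy : y ∈ A
      · exact Or.inr ⟨hx, hy⟩
      · exact absurd (hxy.symm.trans (hin x hx)) (hout y hy)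
    · by_cases hy : y ∈ A
      · exact absurd (hxy.trans (hin y hy)) (hout x hx)
      · left
        have : e ⟨x, hx⟩ = e ⟨y, hy⟩ := Subtype.ext (by rw [he, he]; exact hxy)
        exact congrArg Subtype.val (e.injective this)
  · rintro (rfl | ⟨hx, hy⟩)
    · rfl
    · rw [hin x hx, hin y hy]

/-- A continuous surjection from a compact space to a Hausdorff space whose fibers are `A` and
singletons maps the complement of `A` homeomorphically. -/
theorem mapsHomeomorphicallyOnto_of_fibers {X : Type u} {Y : Type v} [TopologicalSpace X]
    [CompactSpace X] [TopologicalSpace Y] [T2Space Y] {f : X → Y} (hf : Continuous f)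
    (hsurj : Surjective f) {A : Set X} {p : Y} (hA : f '' A = {p})
    (hfib : ∀ x y : X, f x = f y ↔ x = y ∨ (x ∈ A ∧ y ∈ A)) :
    MapsHomeomorphicallyOnto f Aᶜ {p}ᶜ := by
  have hpre : Aᶜ = f ⁻¹' {p}ᶜ := by
    ext x
    rw [mem_preimage, mem_compl_iff, mem_compl_iff, not_iff_not, ← hA]
    refine ⟨fun hx => ⟨x, hx, rfl⟩, ?_⟩
    rintro ⟨y, hy, hyx⟩
    obtain rfl | h := (hfib y x).1 hyx
    exacts [hy, h.2]
  rw [hpre]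
  have hinj : Injective (restrictPreimage {p}ᶜ f) := by
    rintro ⟨x, hx⟩ ⟨y, hy⟩ hxy
    obtain h | h := (hfib x y).1 (congrArg Subtype.val hxy)
    · exact Subtype.ext h
    · rw [← hpre] at hx
      exact absurd h.1 hx
  have hclosed : IsClosedMap (restrictPreimage {p}ᶜ f) := hf.isClosedMap.restrictPreimage _
  refine ⟨(Equiv.ofBijective _ ⟨hinj, hsurj.restrictPreimage _⟩).toHomeomorphOfContinuousClosed
    (hf.restrictPreimage) hclosed, fun x => rfl⟩

/-- Squashing `B ⊆ A` while keeping the other members of a null decomposition containing `A`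
small or fixed. -/
theorem Squashable.exists_squash_refinement {X : Type u} [MetricSpace X] {A B : Set X}
    (hBA : B ⊆ A) (hBsq : Squashable B) {𝒢 : Set (Set X)} (hG : IsUSCDecomposition 𝒢)
    (hn : IsNullCollection 𝒢) (hA : A ∈ 𝒢) {U : Set X} (hU : IsOpen U) (hAU : A ⊆ U) {δ : ℝ}
    (hδ : 0 < δ) :
    ∃ f : C(X, X),
      f ∈ closure ((fun h : X ≃ₜ X => (h : C(X, X))) '' {h : X ≃ₜ X | ∀ x ∈ Uᶜ, h x = x}) ∧
      Surjective f ∧ (∀ x y : X, f x = f y ↔ x = y ∨ (x ∈ B ∧ y ∈ B)) ∧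
      ∀ G ∈ 𝒢, G ≠ A → Metric.diam (⇑f '' G) < δ ∨ ∀ x ∈ G, f x = x := by
  obtain rfl | hBne := B.eq_empty_or_nonempty
  · refine ⟨ContinuousMap.id X, subset_closure ⟨Homeomorph.refl X, fun x _ => rfl, rfl⟩,
      surjective_id, by simp, fun G _ _ => Or.inr fun x _ => rfl⟩
  set 𝒢' : Set (Set X) := {G | G ∈ 𝒢 ∧ G ≠ A} ∪ {B} ∪ (fun x => {x}) '' (A \ B) with h𝒢'
  have hn' : IsNullCollection 𝒢' := by
    intro ε hε
    refine ((hn ε hε).union (finite_singleton B)).subset ?_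
    rintro C ⟨(⟨hC, -⟩ | hC) | ⟨x, -, rfl⟩, hd⟩
    · exact Or.inl ⟨hC, hd⟩
    · exact Or.inr hC
    · simp only [Metric.diam_singleton] at hd
      exact absurd hd hε.not_ge
  have hG' : IsUSCDecomposition 𝒢' := by
    refine isUSCDecomposition_of_isNullCollection ?_ ?_ hn'
    · rintro C ((⟨hC, -⟩ | rfl) | ⟨x, -, rfl⟩)
      exacts [hG.1 C hC, ⟨hBsq.1, hBne⟩, ⟨isCompact_singleton, singleton_nonempty x⟩]
    · intro x
      have hoff : ∀ G ∈ 𝒢, G ≠ A → x ∈ G → x ∉ A := fun G hGG hne hx hxA =>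
        hne ((hG.2.1 x).unique ⟨hGG, hx⟩ ⟨hA, hxA⟩)
      by_cases hxB : x ∈ B
      · refine ⟨B, ⟨Or.inl (Or.inr rfl), hxB⟩, ?_⟩
        rintro C ⟨(⟨hC, hne⟩ | hC) | ⟨y, hy, rfl⟩, hx⟩
        · exact absurd (hBA hxB) (hoff C hC hne hx)
        · exact hC
        · obtain rfl : x = y := hx
          exact absurd hxB hy.2
      · by_cases hxA : x ∈ A
        · refine ⟨{x}, ⟨Or.inr ⟨x, ⟨hxA, hxB⟩, rfl⟩, rfl⟩, ?_⟩
          rintro C ⟨(⟨hC, hne⟩ | rfl) | ⟨y, hy, rfl⟩, hx⟩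
          · exact absurd hxA (hoff C hC hne hx)
          · exact absurd hx hxB
          · obtain rfl : x = y := hx
            rfl
        · obtain ⟨G, ⟨hGG, hx⟩, hu⟩ := hG.2.1 x
          refine ⟨G, ⟨Or.inl (Or.inl ⟨hGG, fun h => hxA (h ▸ hx)⟩), hx⟩, ?_⟩
          rintro C ⟨(⟨hC, hne⟩ | rfl) | ⟨y, hy, rfl⟩, hx'⟩
          · exact hu C ⟨hC, hx'⟩
          · exact absurd hx' hxB
          · obtain rfl : x = y := hx'
            exact absurd hy.1 hxA
  obtain ⟨f, p, hcl, hfB, hhom, hsmall⟩ :=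
    hBsq.2 𝒢' hG' hn' (Or.inl (Or.inr rfl)) U hU (hBA.trans hAU) δ hδ
  obtain ⟨hs, hfib⟩ := hhom.surjective_and_fibers hfB
  exact ⟨f, hcl, hs, hfib, fun G hGG hne => hsmall G (Or.inl (Or.inl ⟨hGG, hne⟩))⟩

/-- Two continuous surjections from a compact space to Hausdorff spaces with the same fibers
differ by a homeomorphism. -/
theorem exists_homeomorph_of_same_fibers {X : Type*} {Y : Type*} {Z : Type*} [TopologicalSpace X]
    [CompactSpace X] [TopologicalSpace Y] [T2Space Y] [TopologicalSpace Z] [T2Space Z]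
    {f : X → Y} {g : X → Z} (hf : Continuous f) (hfs : Surjective f) (hg : Continuous g)
    (hgs : Surjective g) (h : ∀ x y, f x = f y ↔ g x = g y) :
    ∃ φ : Y ≃ₜ Z, ∀ x, φ (f x) = g x := by
  have hq := hf.isClosedMap.isQuotientMap hf hfs
  set φ : Y → Z := g ∘ surjInv hfs with hφ
  have hφf : ∀ x, φ (f x) = g x := fun x => (h _ _).1 (surjInv_eq hfs (f x))
  have hφc : Continuous φ := hq.continuous_iff.2 (by
    rw [show φ ∘ f = g from funext hφf]
    exact hg)
  have hbij : Bijective φ := by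
    refine ⟨fun a b hab => ?_, fun z => ?_⟩
    · obtain ⟨x, rfl⟩ := hfs a
      obtain ⟨y, rfl⟩ := hfs b
      rwa [hφf, hφf, ← h] at hab
    · obtain ⟨x, rfl⟩ := hgs z
      exact ⟨f x, hφf x⟩
  have : CompactSpace Y := ⟨by rw [← hfs.range_eq]; exact isCompact_range hf⟩
  exact ⟨Continuous.homeoOfEquivCompactToT2 (f := Equiv.ofBijective φ hbij) hφc, hφf⟩

/-- Maps in the closure of the homeomorphisms fixing `C` pointwise fix `C` pointwise. -/
theorem apply_eq_of_mem_closure_homeomorph {X : Type u} [MetricSpace X] {C : Set X} {f : C(X, X)}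
    (hf : f ∈ closure ((fun h : X ≃ₜ X => (h : C(X, X))) '' {h : X ≃ₜ X | ∀ x ∈ C, h x = x}))
    {x : X} (hx : x ∈ C) : f x = x := by
  have hclosed : IsClosed {g : C(X, X) | g x = x} :=
    isClosed_eq (continuous_eval_const x) continuous_const
  refine closure_minimal ?_ hclosed hf
  rintro _ ⟨h, hh, rfl⟩
  exact hh x hx

/-- The closure of the homeomorphisms fixing `C` pointwise is closed under composition. -/
theorem comp_mem_closure_homeomorph {X : Type u} [MetricSpace X] [CompactSpace X] {C : Set X}
    {f g : C(X, X)}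
    (hf : f ∈ closure ((fun h : X ≃ₜ X => (h : C(X, X))) '' {h : X ≃ₜ X | ∀ x ∈ C, h x = x}))
    (hg : g ∈ closure ((fun h : X ≃ₜ X => (h : C(X, X))) '' {h : X ≃ₜ X | ∀ x ∈ C, h x = x})) :
    f.comp g ∈
      closure ((fun h : X ≃ₜ X => (h : C(X, X))) '' {h : X ≃ₜ X | ∀ x ∈ C, h x = x}) := by
  refine map_mem_closure₂ (f := fun g f : C(X, X) => f.comp g) ContinuousMap.continuous_comp' hg hf ?_
  rintro _ ⟨k, hk, rfl⟩ _ ⟨h, hh, rfl⟩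
  refine ⟨k.trans h, fun x hx => ?_, rfl⟩
  rw [Homeomorph.trans_apply, hk x hx, hh x hx]

/-- Conjugation by a homeomorphism preserves closures of groups of homeomorphisms with
prescribed support. -/
theorem conj_mem_closure_homeomorph {X : Type u} {Y : Type v} [MetricSpace X] [MetricSpace Y]
    (φ : X ≃ₜ Y) {C : Set X} {g : C(Y, Y)}
    (hg : g ∈ closure ((fun h : Y ≃ₜ Y => (h : C(Y, Y))) ''
      {h : Y ≃ₜ Y | ∀ y ∈ φ.symm ⁻¹' C, h y = y})) :
    ((φ.symm : C(Y, X)).comp (g.comp (φ : C(X, Y)))) ∈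
      closure ((fun h : X ≃ₜ X => (h : C(X, X))) '' {h : X ≃ₜ X | ∀ x ∈ C, h x = x}) := by
  refine map_mem_closure (f := fun g : C(Y, Y) =>
    (φ.symm : C(Y, X)).comp (g.comp (φ : C(X, Y))))
    ((ContinuousMap.continuous_postcomp _).comp (ContinuousMap.continuous_precomp _)) hg ?_
  rintro _ ⟨h, hh, rfl⟩
  refine ⟨(φ.trans h).trans φ.symm, fun x hx => ?_, rfl⟩
  have := hh (φ x) (by simpa using hx)
  simp [this]

/-- **Key step of Theorem 4.** If `B ⊆ A` are compact subsets of a compact metric space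
`X` such that `B` is squashable in `X` and the image `A/B` of `A` in the quotient `X/B`
is squashable in `X/B` (with respect to some metric inducing the quotient topology),
then `A` is squashable in `X`. The quotient `X/B` is modelled by a compact metric space
`Y` together with a continuous surjection `π : X → Y` whose fibers are `B` and the
singletons of `X − B` (such a map is automatically a closed quotient map, so `Y` is
`X/B` endowed with a metric inducing the quotient topology). -/
theorem squashable_of_squashable_quotient {X : Type u} {Y : Type v}
    [MetricSpace X] [CompactSpace X] [MetricSpace Y] [CompactSpace Y]
    (B A : Set X) (hBA : B ⊆ A) (hB : IsCompact B) (hA : IsCompact A)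
    (hBsq : Squashable B)
    (π : X → Y) (hπ : Continuous π) (hsurj : Function.Surjective π)
    (hfib : ∀ x y : X, π x = π y ↔ x = y ∨ (x ∈ B ∧ y ∈ B))
    (hABsq : Squashable (π '' A)) :
    Squashable A := by
  refine ⟨hA, fun 𝒢 hG hn hA𝒢 U hU hAU δ hδ => ?_⟩
  obtain ⟨f, hfcl, hfs, hffib, hfsmall⟩ :=
    hBsq.exists_squash_refinement hBA hG hn hA𝒢 hU hAU hδ
  obtain ⟨φ, hφ⟩ := exists_homeomorph_of_same_fibers f.continuous hfs hπ hsurj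
    fun x y => (hffib x y).trans (hfib x y).symm
  have hsymm : ∀ x, φ.symm (π x) = f x := fun x => by rw [← hφ, φ.symm_apply_apply]
  have hAV : π '' A ⊆ φ.symm ⁻¹' U := by
    rintro _ ⟨x, hx, rfl⟩
    rw [mem_preimage, hsymm]
    by_contra hfx
    have hfix := apply_eq_of_mem_closure_homeomorph hfcl hfx
    obtain h | h := (hffib _ _).1 hfix
    · exact hfx (by rw [h]; exact hAU hx)
    · exact hfx (hAU (hBA h.1))
  obtain ⟨hGπ, hnπ⟩ := image_decomposition hπ hsurj hBA hfib hG hn hA𝒢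
  obtain ⟨η, hη, hdiam⟩ := exists_diam_image_lt φ.symm.continuous hδ
  obtain ⟨g, q, hgcl, hgA, hghom, hgsmall⟩ := hABsq.2 _ hGπ hnπ ⟨A, hA𝒢, rfl⟩
    (φ.symm ⁻¹' U) (hU.preimage φ.symm.continuous) hAV η hη
  obtain ⟨hgs, hgfib⟩ := hghom.surjective_and_fibers hgA
  set F : C(X, X) := ((φ.symm : C(Y, X)).comp (g.comp (φ : C(X, Y)))).comp f with hF
  have hFx : ∀ x, F x = φ.symm (g (π x)) := fun x => by simp [hF, hφ]
  have hFimage : ∀ S : Set X, ⇑F '' S = φ.symm '' (g '' (π '' S)) := fun S => by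
    rw [image_image, image_image]
    exact image_congr fun x _ => hFx x
  have hFA : ⇑F '' A = {φ.symm q} := by rw [hFimage, hgA, image_singleton]
  have hFs : Surjective F := by
    rw [show ⇑F = φ.symm ∘ g ∘ π from funext hFx]
    exact φ.symm.surjective.comp (hgs.comp hsurj)
  have hmemA : ∀ x, π x ∈ π '' A ↔ x ∈ A := fun x => by
    refine ⟨?_, mem_image_of_mem π⟩
    rintro ⟨y, hy, hyx⟩
    obtain rfl | h := (hfib y x).1 hyx
    exacts [hy, hBA h.2]
  have hFfib : ∀ x y, F x = F y ↔ x = y ∨ (x ∈ A ∧ y ∈ A) := fun x y => by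
    rw [hFx, hFx, φ.symm.injective.eq_iff, hgfib, hmemA, hmemA, hfib]
    constructor
    · rintro ((h | h) | h)
      exacts [Or.inl h, Or.inr ⟨hBA h.1, hBA h.2⟩, Or.inr h]
    · rintro (h | h)
      exacts [Or.inl (Or.inl h), Or.inr h]
  refine ⟨F, φ.symm q, comp_mem_closure_homeomorph (conj_mem_closure_homeomorph φ hgcl) hfcl,
    hFA, mapsHomeomorphicallyOnto_of_fibers F.continuous hFs hFA hFfib, fun G hGG => ?_⟩
  obtain rfl | hne := eq_or_ne G A
  · left
    rw [hFA, Metric.diam_singleton]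
    exact hδ
  obtain h | h := hgsmall _ ⟨G, hGG, rfl⟩
  · left
    rw [hFimage]
    exact hdiam _ h
  · have hFf : ∀ x ∈ G, F x = f x := fun x hx => by
      rw [hFx, h _ (mem_image_of_mem π hx), hsymm]
    rw [image_congr hFf]
    exact (hfsmall G hGG hne).imp_right fun hf x hx => (hFf x hx).trans (hf x hx)
end
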